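/- Let I = (f_1,…,f_n) be a generic ideal of type (n; d_1,…,d_n) in K[x_1,…,x_n] with n ≥ 4 and d_1 ≤ ⋯ ≤ d_n. If d_i ≥ σ_{i−1} for every 4 ≤ i ≤ n, then every minimal generator of in(I) satisfies property P with respect to in(I); that is, Conjecture E holds for I. -/

import Mathlib

open MvPolynomial

/-- The total degree of an exponent vector. -/
def expDeg {n : ℕ} (μ : Fin n →₀ ℕ) : ℕ := μ.sum fun _ e => e

/-- Strict degree reverse lexicographic order on exponent vectors, for variables
`x_1 > ⋯ > x_n` (indexed by `Fin n` in this order). -/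
def DrlLT {n : ℕ} (a b : Fin n →₀ ℕ) : Prop :=
  expDeg a < expDeg b ∨
    (expDeg a = expDeg b ∧ ∃ i : Fin n, b i < a i ∧ ∀ j : Fin n, i < j → a j = b j)

/-- `μ` is the leading (degrevlex-largest) exponent of `p`. -/
def IsLeadExp {n : ℕ} {K : Type*} [CommSemiring K] (p : MvPolynomial (Fin n) K)
    (μ : Fin n →₀ ℕ) : Prop :=
  μ ∈ p.support ∧ ∀ ν ∈ p.support, ν ≠ μ → DrlLT ν μ

/-- The initial ideal of `I` with respect to the degree reverse lexicographic order. -/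
noncomputable def initialIdeal {n : ℕ} {K : Type*} [CommRing K]
    (I : Ideal (MvPolynomial (Fin n) K)) : Ideal (MvPolynomial (Fin n) K) :=
  Ideal.span { m | ∃ p ∈ I, p ≠ 0 ∧ ∃ μ, IsLeadExp p μ ∧ m = monomial μ (1 : K) }

/-- The standard monomials of degree `i` of `I` : exponents of the monomials of degree `i`
not lying in the initial ideal of `I`. -/
def stdMon {n : ℕ} {K : Type*} [CommRing K] (I : Ideal (MvPolynomial (Fin n) K)) (i : ℕ) :
    Set (Fin n →₀ ℕ) :=
  { μ | expDeg μ = i ∧ monomial μ (1 : K) ∉ initialIdeal I }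

/-- `μ` is a minimal monomial generator of the monomial ideal `M`. -/
def IsMinGen {n : ℕ} {K : Type*} [CommRing K] (M : Ideal (MvPolynomial (Fin n) K))
    (μ : Fin n →₀ ℕ) : Prop :=
  monomial μ (1 : K) ∈ M ∧ ∀ ν : Fin n →₀ ℕ, ν ≤ μ → ν ≠ μ → monomial ν (1 : K) ∉ M

/-- `μ` satisfies property `P` with respect to the monomial ideal `M`: if `m` is the largest
index of a variable dividing `x^μ`, then every monomial of the same degree in the variables of
index `< m` also lies in `M`. -/
def SatisfiesP {n : ℕ} {K : Type*} [CommRing K] (M : Ideal (MvPolynomial (Fin n) K))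
    (μ : Fin n →₀ ℕ) : Prop :=
  ∀ m : Fin n, μ m ≠ 0 → (∀ j : Fin n, m < j → μ j = 0) →
    ∀ ν : Fin n →₀ ℕ, expDeg ν = expDeg μ → (∀ j : Fin n, m ≤ j → ν j = 0) →
      monomial ν (1 : K) ∈ M

/-- Conjecture E (Pardue) holds for the ideal `I`: every minimal generator of the initial
ideal of `I` satisfies property `P`. -/
def ConjE {n : ℕ} {K : Type*} [CommRing K] (I : Ideal (MvPolynomial (Fin n) K)) : Prop :=
  ∀ μ, IsMinGen (initialIdeal I) μ → SatisfiesP (initialIdeal I) μ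

/-- `f` is a generic sequence of forms of degrees `d i` over the base field `F`: each `f i` is
homogeneous of degree `d i` and the family of all coefficients (at all monomials of degree
`d i`) is algebraically independent over `F`. -/
def IsGenericSeq (F : Type*) {K : Type*} [CommRing F] [CommRing K] [Algebra F K]
    {n r : ℕ} (d : Fin r → ℕ) (f : Fin r → MvPolynomial (Fin n) K) : Prop :=
  (∀ i, (f i).IsHomogeneous (d i)) ∧
    AlgebraicIndependent F
      (fun p : Σ i : Fin r, { μ : Fin n →₀ ℕ // expDeg μ = d i } => (f p.1).coeff p.2.1)

/-- The projection `K[x_1,…,x_n,z] → K[x_1,…,x_n]` sending `z` (the last variable) to `0` and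
fixing the other variables. -/
noncomputable def projMap (K : Type*) [CommRing K] (n : ℕ) :
    MvPolynomial (Fin (n + 1)) K →ₐ[K] MvPolynomial (Fin n) K :=
  aeval (fun i => Fin.lastCases 0 (fun j => X j) i)

/-- Embedding of exponent vectors of `K[x_1,…,x_n]` into those of `K[x_1,…,x_n,z]`
(`z`-exponent `0`). -/
noncomputable def embExp {n : ℕ} (μ : Fin n →₀ ℕ) : Fin (n + 1) →₀ ℕ :=
  Finsupp.embDomain ⟨Fin.castSucc, Fin.castSucc_injective n⟩ μ

/-- Multiplication by `z^c` on exponent vectors in `K[x_1,…,x_n,z]`. -/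
noncomputable def zShift {n : ℕ} (c : ℕ) (μ : Fin (n + 1) →₀ ℕ) : Fin (n + 1) →₀ ℕ :=
  μ + Finsupp.single (Fin.last n) c

/-- `f` (homogeneous of degree `e`) is semi-regular on `R/I`: in each degree `t`, the
multiplication map `(R/I)_t → (R/I)_{t+e}` is injective or surjective. -/
def SemiRegularOn {vars K : Type*} [CommRing K] (I : Ideal (MvPolynomial vars K))
    (f : MvPolynomial vars K) (e : ℕ) : Prop :=
  ∀ t : ℕ,
    (∀ p ∈ homogeneousSubmodule vars K t, f * p ∈ I → p ∈ I) ∨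
    (∀ q ∈ homogeneousSubmodule vars K (t + e),
      ∃ p ∈ homogeneousSubmodule vars K t, q - f * p ∈ I)

/-- The degree-`t` graded piece of `R/I`, as a `K`-submodule of the quotient. -/
noncomputable def quotDegPart {vars K : Type*} [CommRing K] (I : Ideal (MvPolynomial vars K))
    (t : ℕ) : Submodule K (MvPolynomial vars K ⧸ I) :=
  (homogeneousSubmodule vars K t).map (Ideal.Quotient.mkₐ K I).toLinearMap

/-- The rows of a matrix with linearly independent columns contain an invertible square block. -/
lemma exists_submatrix_det_ne_zero {K T P : Type*} [Field K] [Fintype P] [DecidableEq P]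
    (v : P → T → K) (hv : LinearIndependent K v) :
    ∃ e : P → T, (Matrix.of fun p q => v q (e p)).det ≠ 0 := by
  set row : T → P → K := fun τ p => v p τ
  have hspan : Submodule.span K (Set.range row) = ⊤ := by
    by_contra hne
    obtain ⟨g, hg0, hg⟩ := Submodule.exists_le_ker_of_lt_top _ (lt_top_iff_ne_top.2 hne)
    apply hg0
    have hrel : ∑ p, g (Pi.single p 1) • v p = 0 := by
      funext τ
      have h1 : g (row τ) = 0 := hg (Submodule.subset_span ⟨τ, rfl⟩)
      rw [LinearMap.pi_apply_eq_sum_univ g (row τ)] at h1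
      have h2 : ∀ p : P, (fun j => if p = j then (1 : K) else 0) = Pi.single p 1 := fun p => by
        funext j
        simp [Pi.single_apply, eq_comm]
      simpa only [h2, row, Finset.sum_apply, Pi.smul_apply, smul_eq_mul, mul_comm,
        Pi.zero_apply] using h1
    have h0 := Fintype.linearIndependent_iff.1 hv _ hrel
    apply LinearMap.pi_ext'
    intro p
    ext
    simpa using h0 p
  obtain ⟨κ, a, -, ha, hli⟩ := exists_linearIndependent' K row
  rw [hspan] at ha
  let b : Module.Basis κ K (P → K) := Module.Basis.mk hli ha.ge
  let e : P ≃ κ := (Pi.basisFun K P).indexEquiv b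
  refine ⟨a ∘ e, ?_⟩
  have h2 : LinearIndependent K (fun p => row (a (e p))) := hli.comp e e.injective
  have h3 : IsUnit (Matrix.of fun p q => v q ((a ∘ e) p)) :=
    Matrix.linearIndependent_rows_iff_isUnit.1 h2
  exact ((Matrix.isUnit_iff_isUnit_det _).1 h3).ne_zero

/-- The dimension of the span of a polynomial family of vectors does not drop when a
specialization is replaced by algebraically independent values. -/
lemma finrank_span_specialize_le {F K C P τ : Type*} [Field F] [Field K] [Algebra F K]
    (c c' : C → K) (hc : AlgebraicIndependent F c)
    (W : P → MvPolynomial τ (MvPolynomial C F))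
    [FiniteDimensional K (Submodule.span K
      (Set.range fun p => map (aeval c : MvPolynomial C F →ₐ[F] K).toRingHom (W p)))]
    [FiniteDimensional K (Submodule.span K
      (Set.range fun p => map (aeval c' : MvPolynomial C F →ₐ[F] K).toRingHom (W p)))] :
    Module.finrank K (Submodule.span K
      (Set.range fun p => map (aeval c' : MvPolynomial C F →ₐ[F] K).toRingHom (W p))) ≤
    Module.finrank K (Submodule.span K
      (Set.range fun p => map (aeval c : MvPolynomial C F →ₐ[F] K).toRingHom (W p))) := by
  classical
  set v' := fun p => map (aeval c' : MvPolynomial C F →ₐ[F] K).toRingHom (W p) with hv'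
  set v := fun p => map (aeval c : MvPolynomial C F →ₐ[F] K).toRingHom (W p) with hv
  obtain ⟨κ, a, -, ha, hli⟩ := exists_linearIndependent' K v'
  have : FiniteDimensional K (Submodule.span K (Set.range (v' ∘ a))) := by rw [ha]; infer_instance
  have hfin : Finite κ := by
    have h := (linearIndependent_span hli).finite
    exact h
  cases nonempty_fintype κ
  have hcoeff : LinearIndependent K (fun (k : κ) (t : τ →₀ ℕ) => coeff t (v' (a k))) :=
    hli.map' (Finsupp.lcoeFun (R := K) (M := K) (α := τ →₀ ℕ) ∘ₗ
      (AddMonoidAlgebra.coeffLinearEquiv K).toLinearMap) (by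
      rw [LinearMap.ker_eq_bot]
      intro x y h
      ext t
      exact congrFun h t)
  obtain ⟨e, he⟩ := exists_submatrix_det_ne_zero _ hcoeff
  set D : MvPolynomial C F := (Matrix.of fun p q => coeff (e p) (W (a q))).det with hD
  have hspec : ∀ c₀ : C → K, aeval c₀ D = (Matrix.of fun p q => coeff (e p)
      (map (aeval c₀ : MvPolynomial C F →ₐ[F] K).toRingHom (W (a q)))).det := by
    intro c₀
    rw [hD, AlgHom.map_det]
    congr 1
  have hD0 : D ≠ 0 := by
    intro h
    apply he
    have := hspec c'
    rw [h, map_zero] at this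
    exact this.symm
  have hdet : (Matrix.of fun p q => coeff (e p) (v (a q))).det ≠ 0 := by
    rw [← hspec c]
    intro h
    exact hD0 ((injective_iff_map_eq_zero _).1 hc D h)
  have hli2 : LinearIndependent K (v ∘ a) := by
    have h1 : LinearIndependent K (fun q p => coeff (e p) (v (a q))) :=
      Matrix.linearIndependent_cols_iff_isUnit.2
        ((Matrix.isUnit_iff_isUnit_det _).2 (isUnit_iff_ne_zero.2 hdet))
    exact LinearIndependent.of_comp
      (LinearMap.pi fun p => (lcoeff K (e p) : MvPolynomial τ K →ₗ[K] K)) h1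
  rw [← ha, finrank_span_eq_card hli, ← finrank_span_eq_card hli2]
  exact Submodule.finrank_mono (Submodule.span_mono (Set.range_comp_subset_range _ _))

/-- An ideal containing the homogeneous components of each of its elements. -/
def IsGradedIdeal {σ K : Type*} [CommRing K] (J : Ideal (MvPolynomial σ K)) : Prop :=
  ∀ p ∈ J, ∀ t, homogeneousComponent t p ∈ J

lemma isGradedIdeal_span {σ K : Type*} [CommRing K] {s : Set (MvPolynomial σ K)}
    (hs : ∀ p ∈ s, ∃ e, p.IsHomogeneous e) : IsGradedIdeal (Ideal.span s) := by
  let _ : GradedAlgebra (homogeneousSubmodule σ K) := MvPolynomial.gradedAlgebra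
  intro p hp t
  exact MvPolynomial.homogeneousComponent_mem_of_mem
    (Ideal.homogeneous_span (homogeneousSubmodule σ K) s fun x hx => hs x hx) hp t

lemma homogeneousComponent_mul_of_isHomogeneous {σ K : Type*} [CommRing K]
    {f : MvPolynomial σ K} {e : ℕ} (hf : f.IsHomogeneous e) (p : MvPolynomial σ K) (t : ℕ) :
    homogeneousComponent t (p * f) = if e ≤ t then homogeneousComponent (t - e) p * f else 0 := by
  conv_lhs => rw [← sum_homogeneousComponent p]
  rw [Finset.sum_mul, map_sum]
  have h : ∀ i, homogeneousComponent t (homogeneousComponent i p * f) =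
      if i + e = t then homogeneousComponent i p * f else 0 := fun i => by
    rw [homogeneousComponent_of_mem (n := i + e) (m := t)
      ((homogeneousComponent_isHomogeneous i p).mul hf)]
    split_ifs <;> first | rfl | omega
  simp only [h]
  split_ifs with het
  · rw [Finset.sum_eq_single (t - e)]
    · rw [if_pos (by omega)]
    · intro b _ hb
      rw [if_neg (by omega)]
    · intro hb
      rw [homogeneousComponent_eq_zero]
      · simp
      · simp only [Finset.mem_range] at hb
        omega
  · apply Finset.sum_eq_zero
    intro b _
    rw [if_neg (by omega)]

/-- The degree-`t` part of an ideal. -/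
noncomputable def degPart {σ K : Type*} [CommRing K] (J : Ideal (MvPolynomial σ K)) (t : ℕ) :
    Submodule K (MvPolynomial σ K) :=
  J.restrictScalars K ⊓ homogeneousSubmodule σ K t

lemma degPart_le {σ K : Type*} [CommRing K] (J : Ideal (MvPolynomial σ K)) (t : ℕ) :
    degPart J t ≤ homogeneousSubmodule σ K t := inf_le_right

lemma degPart_mono {σ K : Type*} [CommRing K] {J L : Ideal (MvPolynomial σ K)} (h : J ≤ L)
    (t : ℕ) : degPart J t ≤ degPart L t := fun _ hp => ⟨h hp.1, hp.2⟩

section Hilbert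

variable {σ K : Type*} [Field K]

instance finiteDimensional_homogeneousSubmodule [Finite σ] (t : ℕ) :
    FiniteDimensional K (homogeneousSubmodule σ K t) :=
  Module.Finite.iff_fg.2 (homogeneousSubmodule_fg σ K t)

instance finiteDimensional_degPart [Finite σ] (J : Ideal (MvPolynomial σ K)) (t : ℕ) :
    FiniteDimensional K (degPart J t) :=
  Submodule.finiteDimensional_of_le (degPart_le J t)

/-- The Hilbert function of the quotient by `J`. -/
noncomputable def hilb (J : Ideal (MvPolynomial σ K)) (t : ℕ) : ℕ :=
  Module.finrank K (homogeneousSubmodule σ K t) - Module.finrank K (degPart J t)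

lemma degPart_finrank_le [Finite σ] (J : Ideal (MvPolynomial σ K)) (t : ℕ) :
    Module.finrank K (degPart J t) ≤ Module.finrank K (homogeneousSubmodule σ K t) :=
  Submodule.finrank_mono (degPart_le J t)

lemma hilb_add [Finite σ] (J : Ideal (MvPolynomial σ K)) (t : ℕ) :
    hilb J t + Module.finrank K (degPart J t) =
      Module.finrank K (homogeneousSubmodule σ K t) :=
  Nat.sub_add_cancel (degPart_finrank_le J t)

lemma hilb_anti [Finite σ] {J L : Ideal (MvPolynomial σ K)} (h : J ≤ L) (t : ℕ) :
    hilb L t ≤ hilb J t := by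
  have h1 := hilb_add J t
  have h2 := hilb_add L t
  have h3 := Submodule.finrank_mono (degPart_mono h t)
  omega

lemma le_of_hilb_eq_zero [Finite σ] {J : Ideal (MvPolynomial σ K)} {t : ℕ} (h : hilb J t = 0)
    {p : MvPolynomial σ K} (hp : p.IsHomogeneous t) : p ∈ J := by
  have h1 := hilb_add J t
  have h2 : degPart J t = homogeneousSubmodule σ K t :=
    Submodule.eq_of_le_of_finrank_le (degPart_le J t) (by omega)
  have h3 : p ∈ degPart J t := by
    rw [h2]
    exact hp
  exact h3.1

lemma hilb_sup_lt [Finite σ] {J : Ideal (MvPolynomial σ K)} {t : ℕ} {f : MvPolynomial σ K}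
    (hf : f.IsHomogeneous t) (hfJ : f ∉ J) : hilb (J ⊔ Ideal.span {f}) t + 1 ≤ hilb J t := by
  have h1 := hilb_add J t
  have h2 := hilb_add (J ⊔ Ideal.span {f}) t
  have h3 : degPart J t < degPart (J ⊔ Ideal.span {f}) t := by
    refine lt_of_le_of_ne (degPart_mono le_sup_left t) fun h => hfJ ?_
    have h4 : f ∈ degPart (J ⊔ Ideal.span {f}) t :=
      ⟨Ideal.mem_sup_right (Ideal.mem_span_singleton_self f), hf⟩
    rw [← h] at h4
    exact h4.1
  have h5 := Submodule.finrank_lt_finrank_of_lt h3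
  omega

lemma degPart_sup_span_singleton_of_lt {J : Ideal (MvPolynomial σ K)} (hJ : IsGradedIdeal J)
    {f : MvPolynomial σ K} {e t : ℕ} (hf : f.IsHomogeneous e) (het : t < e) :
    degPart (J ⊔ Ideal.span {f}) t = degPart J t := by
  refine le_antisymm ?_ (degPart_mono le_sup_left t)
  rintro p ⟨hp, hpt⟩
  obtain ⟨a, ha, b, hb, hab⟩ := Submodule.mem_sup.1 hp
  obtain ⟨q, rfl⟩ := Ideal.mem_span_singleton'.1 hb
  refine ⟨?_, hpt⟩
  have h := congrArg (homogeneousComponent t) hab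
  rw [map_add, homogeneousComponent_mul_of_isHomogeneous hf, if_neg (by omega), add_zero,
    homogeneousComponent_eq_self hpt] at h
  rw [← h]
  exact hJ a ha t

lemma hilb_sup_span_singleton_of_lt {J : Ideal (MvPolynomial σ K)} (hJ : IsGradedIdeal J)
    {f : MvPolynomial σ K} {e t : ℕ} (hf : f.IsHomogeneous e) (het : t < e) :
    hilb (J ⊔ Ideal.span {f}) t = hilb J t := by
  rw [hilb, hilb, degPart_sup_span_singleton_of_lt hJ hf het]

lemma finrank_degPart_sup_le [Finite σ] {J : Ideal (MvPolynomial σ K)} (hJ : IsGradedIdeal J)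
    {f : MvPolynomial σ K} {e u t : ℕ} (hf : f.IsHomogeneous e) (het : u + e = t)
    (W : Submodule K (MvPolynomial σ K)) (hW : W ≤ homogeneousSubmodule σ K u)
    (hWJ : ∀ q ∈ W, q * f ∈ J) :
    Module.finrank K (degPart (J ⊔ Ideal.span {f}) t) + Module.finrank K W ≤
      Module.finrank K (degPart J t) + Module.finrank K (homogeneousSubmodule σ K u) := by
  obtain ⟨W', hdisj, hsup⟩ := IsModularLattice.exists_disjoint_and_sup_eq hW
  have hW' : W' ≤ homogeneousSubmodule σ K u := hsup ▸ le_sup_right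
  have : FiniteDimensional K W := Submodule.finiteDimensional_of_le hW
  have : FiniteDimensional K W' := Submodule.finiteDimensional_of_le hW'
  have h1 := Submodule.finrank_sup_add_finrank_inf_eq W W'
  rw [hdisj.eq_bot, finrank_bot, add_zero, hsup] at h1
  have h2 : degPart (J ⊔ Ideal.span {f}) t ≤
      degPart J t ⊔ W'.map (LinearMap.mulRight K f) := by
    rintro p ⟨hp, hpt⟩
    obtain ⟨a, ha, b, hb, hab⟩ := Submodule.mem_sup.1 hp
    obtain ⟨q, rfl⟩ := Ideal.mem_span_singleton'.1 hb
    have h := congrArg (homogeneousComponent t) hab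
    rw [map_add, homogeneousComponent_mul_of_isHomogeneous hf, if_pos (by omega),
      homogeneousComponent_eq_self hpt, show t - e = u by omega] at h
    have hq : homogeneousComponent u q ∈ homogeneousSubmodule σ K u :=
      homogeneousComponent_isHomogeneous u q
    rw [← hsup] at hq
    obtain ⟨w, hw, w', hw', hww⟩ := Submodule.mem_sup.1 hq
    rw [← h, ← hww, add_mul, ← add_assoc]
    refine Submodule.add_mem_sup ⟨Ideal.add_mem _ (hJ a ha t) (hWJ w hw), ?_⟩
      ⟨w', hw', rfl⟩
    refine Submodule.add_mem _ (homogeneousComponent_isHomogeneous t a) ?_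
    rw [← het]
    exact IsHomogeneous.mul (hW hw) hf
  have h3 := Submodule.finrank_mono h2
  have h4 := Submodule.finrank_add_le_finrank_add_finrank (degPart J t)
    (W'.map (LinearMap.mulRight K f))
  have h5 := Submodule.finrank_map_le (LinearMap.mulRight K f) W'
  omega

lemma hilb_le_sup_add [Finite σ] {J : Ideal (MvPolynomial σ K)} (hJ : IsGradedIdeal J)
    {f : MvPolynomial σ K} {e u t : ℕ} (hf : f.IsHomogeneous e) (het : u + e = t) :
    hilb J t ≤ hilb (J ⊔ Ideal.span {f}) t + hilb J u := by
  have h1 := finrank_degPart_sup_le hJ hf het (degPart J u) (degPart_le J u)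
    fun q hq => Ideal.mul_mem_right f J hq.1
  have h2 := hilb_add J t
  have h3 := hilb_add (J ⊔ Ideal.span {f}) t
  have h4 := hilb_add J u
  omega

lemma mem_of_mul_mem_of_hilb_le [Finite σ] {J : Ideal (MvPolynomial σ K)} (hJ : IsGradedIdeal J)
    {f : MvPolynomial σ K} {e u t : ℕ} (hf : f.IsHomogeneous e) (het : u + e = t)
    (h : hilb J u + hilb (J ⊔ Ideal.span {f}) t ≤ hilb J t)
    {q : MvPolynomial σ K} (hq : q.IsHomogeneous u) (hqJ : q * f ∈ J) : q ∈ J := by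
  by_contra hcon
  let W : Submodule K (MvPolynomial σ K) := degPart (J ⊔ Ideal.span {q}) u
  have hW : ∀ w ∈ W, w * f ∈ J := by
    rintro w ⟨hw, -⟩
    obtain ⟨a, ha, b, hb, rfl⟩ := Submodule.mem_sup.1 hw
    obtain ⟨c, rfl⟩ := Ideal.mem_span_singleton'.1 hb
    rw [add_mul, mul_assoc]
    exact Ideal.add_mem _ (Ideal.mul_mem_right _ _ ha) (Ideal.mul_mem_left _ _ hqJ)
  have h1 := finrank_degPart_sup_le hJ hf het W (degPart_le _ u) hW
  have h2 := hilb_add J t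
  have h3 := hilb_add (J ⊔ Ideal.span {f}) t
  have h4 := hilb_add J u
  have h5 := hilb_add (J ⊔ Ideal.span {q}) u
  have h6 := hilb_sup_lt hq hcon
  have h7 : Module.finrank K W = Module.finrank K (degPart (J ⊔ Ideal.span {q}) u) := rfl
  omega

end Hilbert

lemma degPart_span_range {σ K ι : Type*} [Field K] (g : ι → MvPolynomial σ K)
    (e : ι → ℕ) (hg : ∀ i, (g i).IsHomogeneous (e i)) (t : ℕ) :
    degPart (Ideal.span (Set.range g)) t = Submodule.span K (Set.range
      fun p : {p : (σ →₀ ℕ) × ι // p.1.degree + e p.2 = t} =>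
        monomial p.1.1 1 * g p.1.2) := by
  apply le_antisymm
  · rintro p ⟨hp, hpt⟩
    suffices h : ∀ q : MvPolynomial σ K, homogeneousComponent t (q * p) ∈ Submodule.span K
        (Set.range fun p : {p : (σ →₀ ℕ) × ι // p.1.degree + e p.2 = t} =>
          monomial p.1.1 1 * g p.1.2) by
      simpa [homogeneousComponent_eq_self hpt] using h 1
    clear hpt
    induction hp using Submodule.span_induction with
    | zero => simp
    | add x y _ _ hx hy =>
      intro q
      rw [mul_add, map_add]
      exact Submodule.add_mem _ (hx q) (hy q)
    | mem x hx =>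
      intro q
      obtain ⟨i, rfl⟩ := hx
      rw [homogeneousComponent_mul_of_isHomogeneous (hg i)]
      split_ifs with h
      · have hq : (homogeneousComponent (t - e i) q).IsHomogeneous (t - e i) :=
          homogeneousComponent_isHomogeneous _ _
        rw [(homogeneousComponent (t - e i) q).as_sum, Finset.sum_mul]
        refine Submodule.sum_mem _ fun ν hν => ?_
        have hdeg : ν.degree = t - e i := by
          by_contra hne
          exact (mem_support_iff.1 hν) (hq.coeff_eq_zero hne)
        have hsm : ∀ c : K, monomial ν c = c • monomial ν (1 : K) := fun c => by
          rw [smul_monomial, smul_eq_mul, mul_one]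
        rw [hsm, smul_mul_assoc]
        exact Submodule.smul_mem _ _ (Submodule.subset_span ⟨⟨(ν, i), by simp only; omega⟩, rfl⟩)
      · exact Submodule.zero_mem _
    | smul a x hx ih =>
      intro q
      rw [smul_eq_mul, ← mul_assoc]
      exact ih _
  · rw [Submodule.span_le]
    rintro _ ⟨⟨⟨ν, i⟩, h⟩, rfl⟩
    refine ⟨Ideal.mul_mem_left _ _ (Ideal.subset_span ⟨i, rfl⟩), ?_⟩
    have h1 := (isHomogeneous_monomial (1 : K) (d := ν) rfl).mul (hg i)
    have h2 : ν.degree + e i = t := h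
    rw [h2] at h1
    exact h1

/-- The generators of `truncIdeal`. -/
noncomputable def truncGen {n : ℕ} {K : Type*} [CommRing K] (f : Fin n → MvPolynomial (Fin n) K)
    (j r : ℕ) : {i : Fin n // i.val < r} ⊕ {l : Fin n // j ≤ l.val} → MvPolynomial (Fin n) K :=
  Sum.elim (fun i => f i) (fun l => X l.1)

/-- The ideal generated by the first `r` forms of a sequence and by the variables of
index at least `j`. -/
noncomputable def truncIdeal {n : ℕ} {K : Type*} [CommRing K]
    (f : Fin n → MvPolynomial (Fin n) K) (j r : ℕ) : Ideal (MvPolynomial (Fin n) K) :=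
  Ideal.span (Set.range (truncGen f j r))

section Trunc

variable {n : ℕ} {K : Type*} [CommRing K] {f : Fin n → MvPolynomial (Fin n) K} {j r : ℕ}

lemma mem_truncIdeal (i : Fin n) (hi : i.val < r) : f i ∈ truncIdeal f j r :=
  Ideal.subset_span ⟨Sum.inl ⟨i, hi⟩, rfl⟩

lemma X_mem_truncIdeal (l : Fin n) (hl : j ≤ l.val) :
    (X l : MvPolynomial (Fin n) K) ∈ truncIdeal f j r :=
  Ideal.subset_span ⟨Sum.inr ⟨l, hl⟩, rfl⟩

lemma truncIdeal_le {J : Ideal (MvPolynomial (Fin n) K)}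
    (h1 : ∀ i : Fin n, i.val < r → f i ∈ J) (h2 : ∀ l : Fin n, j ≤ l.val → X l ∈ J) :
    truncIdeal f j r ≤ J := by
  refine Ideal.span_le.2 ?_
  rintro _ ⟨i | l, rfl⟩
  · exact h1 i.1 i.2
  · exact h2 l.1 l.2

lemma truncIdeal_succ (hr : r < n) :
    truncIdeal f j (r + 1) = truncIdeal f j r ⊔ Ideal.span {f ⟨r, hr⟩} := by
  apply le_antisymm
  · refine truncIdeal_le (fun i hi => ?_) fun l hl => Ideal.mem_sup_left (X_mem_truncIdeal l hl)
    rcases Nat.lt_succ_iff_lt_or_eq.1 hi with h | h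
    · exact Ideal.mem_sup_left (mem_truncIdeal i h)
    · refine Ideal.mem_sup_right ?_
      rw [show i = ⟨r, hr⟩ from Fin.ext h]
      exact Ideal.mem_span_singleton_self _
  · refine sup_le (truncIdeal_le (fun i hi => mem_truncIdeal i (by omega))
      fun l hl => X_mem_truncIdeal l hl) ?_
    rw [Ideal.span_singleton_le_iff_mem]
    exact mem_truncIdeal _ (Nat.lt_succ_self r)

lemma truncIdeal_eq_sup_X (hj : j < n) :
    truncIdeal f j r = truncIdeal f (j + 1) r ⊔ Ideal.span {X ⟨j, hj⟩} := by
  apply le_antisymm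
  · refine truncIdeal_le (fun i hi => Ideal.mem_sup_left (mem_truncIdeal i hi)) fun l hl => ?_
    rcases Nat.eq_or_lt_of_le hl with h | h
    · refine Ideal.mem_sup_right ?_
      rw [show l = ⟨j, hj⟩ from Fin.ext h.symm]
      exact Ideal.mem_span_singleton_self _
    · exact Ideal.mem_sup_left (X_mem_truncIdeal l h)
  · refine sup_le (truncIdeal_le (fun i hi => mem_truncIdeal i hi)
      fun l hl => X_mem_truncIdeal l (by omega)) ?_
    rw [Ideal.span_singleton_le_iff_mem]
    exact X_mem_truncIdeal _ le_rfl

lemma truncIdeal_mono {r' : ℕ} (h : r ≤ r') : truncIdeal f j r ≤ truncIdeal f j r' :=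
  truncIdeal_le (fun i hi => mem_truncIdeal i (by omega)) fun l hl => X_mem_truncIdeal l hl

lemma truncGen_isHomogeneous {d : Fin n → ℕ} (hf : ∀ i, (f i).IsHomogeneous (d i))
    (i : {i : Fin n // i.val < r} ⊕ {l : Fin n // j ≤ l.val}) :
    (truncGen f j r i).IsHomogeneous (Sum.elim (fun i => d i.1) (fun _ => 1) i) := by
  rcases i with i | l
  · exact hf i
  · exact isHomogeneous_X K l.1

lemma isGradedIdeal_truncIdeal {d : Fin n → ℕ} (hf : ∀ i, (f i).IsHomogeneous (d i)) (j r : ℕ) :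
    IsGradedIdeal (truncIdeal f j r) := by
  refine isGradedIdeal_span ?_
  rintro _ ⟨i, rfl⟩
  exact ⟨_, truncGen_isHomogeneous hf i⟩

end Trunc

lemma expDeg_eq_degree {n : ℕ} (μ : Fin n →₀ ℕ) : expDeg μ = μ.degree := rfl

instance finite_expDeg {n : ℕ} (t : ℕ) : Finite {μ : Fin n →₀ ℕ // expDeg μ = t} := by
  refine Set.Finite.to_subtype (s := {μ : Fin n →₀ ℕ | expDeg μ = t}) ?_
  refine Set.Finite.subset ((Finset.univ : Finset (Fin n)).finsuppAntidiag t).finite_toSet ?_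
  intro μ hμ
  have h : μ.degree = t := hμ
  simpa [Finset.mem_finsuppAntidiag, Finsupp.degree_eq_sum] using h

/-- Generic forms minimize the Hilbert function. -/
lemma hilb_truncIdeal_le_of_generic {F K : Type*} [Field F] [Field K] [Algebra F K]
    {n : ℕ} {d : Fin n → ℕ} {f g : Fin n → MvPolynomial (Fin n) K} (hf : IsGenericSeq F d f)
    (hg : ∀ i, (g i).IsHomogeneous (d i)) (j r t : ℕ) :
    hilb (truncIdeal f j r) t ≤ hilb (truncIdeal g j r) t := by
  classical
  let C := Σ i : Fin n, {μ : Fin n →₀ ℕ // expDeg μ = d i}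
  let _ : ∀ i, Fintype {μ : Fin n →₀ ℕ // expDeg μ = d i} := fun i => Fintype.ofFinite _
  let Φ : Fin n → MvPolynomial (Fin n) (MvPolynomial C F) := fun i =>
    ∑ μ : {μ : Fin n →₀ ℕ // expDeg μ = d i}, monomial μ.1 (X (⟨i, μ⟩ : C))
  let cf : (Fin n → MvPolynomial (Fin n) K) → C → K := fun h p => (h p.1).coeff p.2.1
  have hΦ : ∀ h : Fin n → MvPolynomial (Fin n) K, (∀ i, (h i).IsHomogeneous (d i)) → ∀ i,
      map (aeval (cf h) : MvPolynomial C F →ₐ[F] K).toRingHom (Φ i) = h i := by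
    intro h hh i
    simp only [Φ, map_sum, map_monomial]
    ext ν
    rw [coeff_sum]
    simp only [coeff_monomial, AlgHom.toRingHom_eq_coe, RingHom.coe_coe, aeval_X, cf]
    by_cases hν : expDeg ν = d i
    · rw [Finset.sum_eq_single (⟨ν, hν⟩ : {μ : Fin n →₀ ℕ // expDeg μ = d i})]
      · simp
      · intro b _ hb
        rw [if_neg]
        intro hbν
        exact hb (Subtype.ext hbν)
      · simp
    · rw [(hh i).coeff_eq_zero (d := ν) hν]
      apply Finset.sum_eq_zero
      intro b _
      rw [if_neg]
      rintro rfl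
      exact hν b.2
  let e : {i : Fin n // i.val < r} ⊕ {l : Fin n // j ≤ l.val} → ℕ :=
    Sum.elim (fun i => d i.1) (fun _ => 1)
  let W : {p : (Fin n →₀ ℕ) × ({i : Fin n // i.val < r} ⊕ {l : Fin n // j ≤ l.val}) //
      p.1.degree + e p.2 = t} → MvPolynomial (Fin n) (MvPolynomial C F) :=
    fun p => monomial p.1.1 1 * Sum.elim (fun i => Φ i.1) (fun l => X l.1) p.1.2
  have hW : ∀ h : Fin n → MvPolynomial (Fin n) K, (∀ i, (h i).IsHomogeneous (d i)) →
      degPart (truncIdeal h j r) t = Submodule.span K (Set.range fun p =>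
        map (aeval (cf h) : MvPolynomial C F →ₐ[F] K).toRingHom (W p)) := by
    intro h hh
    rw [truncIdeal, degPart_span_range _ e (truncGen_isHomogeneous hh)]
    congr 2
    funext ⟨⟨ν, i⟩, _⟩
    simp only [W, map_mul, map_monomial, map_one]
    congr 1
    rcases i with i | l
    · exact (hΦ h hh i.1).symm
    · simp [truncGen]
  have hd1 := hW f hf.1
  have hd2 := hW g hg
  have : FiniteDimensional K (Submodule.span K (Set.range fun p =>
        map (aeval (cf f) : MvPolynomial C F →ₐ[F] K).toRingHom (W p))) := by
    rw [← hd1]; infer_instance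
  have : FiniteDimensional K (Submodule.span K (Set.range fun p =>
        map (aeval (cf g) : MvPolynomial C F →ₐ[F] K).toRingHom (W p))) := by
    rw [← hd2]; infer_instance
  have h1 := finrank_span_specialize_le (cf f) (cf g) hf.2 W
  rw [← hd1, ← hd2] at h1
  have h2 := hilb_add (truncIdeal f j r) t
  have h3 := hilb_add (truncIdeal g j r) t
  omega

/-- Exponent vectors of degree `t` whose entries are bounded strictly by `e`. -/
def boundedExps {n : ℕ} (e : Fin n → ℕ∞) (t : ℕ) : Set (Fin n →₀ ℕ) :=
  {α | α.degree = t ∧ ∀ i, (α i : ℕ∞) < e i}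

lemma finite_boundedExps {n : ℕ} (e : Fin n → ℕ∞) (t : ℕ) : (boundedExps e t).Finite :=
  (Set.finite_coe_iff.1 (finite_expDeg t)).subset fun _ h => h.1

lemma boundedExps_update_of_lt {n : ℕ} {e : Fin n → ℕ∞} {i : Fin n} (hi : e i = ⊤) {c t : ℕ}
    (h : t < c) : boundedExps (Function.update e i c) t = boundedExps e t := by
  ext α
  refine and_congr_right fun hα => forall_congr' fun j => ?_
  by_cases hj : j = i
  · subst hj
    have h1 : α j ≤ t := hα ▸ Finsupp.le_degree j α
    simp only [Function.update_self, hi, Nat.cast_lt]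
    exact ⟨fun _ => ENat.natCast_lt_top _, fun _ => by omega⟩
  · rw [Function.update_of_ne hj]

lemma ncard_boundedExps_update {n : ℕ} {e : Fin n → ℕ∞} {i : Fin n} (hi : e i = ⊤) {c u t : ℕ}
    (h : u + c = t) : (boundedExps e t).ncard =
      (boundedExps (Function.update e i c) t).ncard + (boundedExps e u).ncard := by
  have hinj : Function.Injective fun α : Fin n →₀ ℕ => α + Finsupp.single i c :=
    add_left_injective _
  have hU : boundedExps e t = boundedExps (Function.update e i c) t ∪
      (fun α : Fin n →₀ ℕ => α + Finsupp.single i c) '' boundedExps e u := by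
    ext α
    constructor
    · rintro ⟨h1, h2⟩
      by_cases hc : c ≤ α i
      · refine Or.inr ⟨α - Finsupp.single i c, ⟨?_, fun j => ?_⟩, ?_⟩
        · have h3 : α - Finsupp.single i c + Finsupp.single i c = α :=
            tsub_add_cancel_of_le (Finsupp.single_le_iff.2 hc)
          have h4 := congrArg Finsupp.degree h3
          rw [map_add, Finsupp.degree_single] at h4
          omega
        · refine lt_of_le_of_lt ?_ (h2 j)
          exact_mod_cast Nat.sub_le _ _
        · exact tsub_add_cancel_of_le (Finsupp.single_le_iff.2 hc)
      · refine Or.inl ⟨h1, fun j => ?_⟩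
        by_cases hj : j = i
        · subst hj
          simpa using hc
        · rw [Function.update_of_ne hj]
          exact h2 j
    · rintro (⟨h1, h2⟩ | ⟨β, ⟨h1, h2⟩, rfl⟩)
      · refine ⟨h1, fun j => ?_⟩
        by_cases hj : j = i
        · subst hj
          rw [hi]
          exact ENat.natCast_lt_top _
        · have := h2 j
          rwa [Function.update_of_ne hj] at this
      · refine ⟨by rw [map_add, Finsupp.degree_single, h1, h], fun j => ?_⟩
        by_cases hj : j = i
        · subst hj
          rw [hi]
          exact ENat.natCast_lt_top _
        · simpa [Finsupp.single_apply, Ne.symm hj] using h2 j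
  rw [hU, Set.ncard_union_eq ?_ (finite_boundedExps _ _) ((finite_boundedExps _ _).image _),
    Set.ncard_image_of_injective _ hinj]
  · rw [Set.disjoint_left]
    rintro _ ⟨-, h2⟩ ⟨β, -, rfl⟩
    have := h2 i
    simp only [Finsupp.add_apply, Finsupp.single_eq_same, Function.update_self, Nat.cast_lt] at this
    omega

/-- Monomials whose exponents are bounded by `e` span the quotient by an ideal containing
rewriting rules for the powers `X i ^ e i`. -/
lemma hilb_le_ncard_boundedExps {n : ℕ} {K : Type*} [Field K] {J : Ideal (MvPolynomial (Fin n) K)}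
    (e : Fin n → ℕ∞) (l : Fin n)
    (hJ : ∀ (i : Fin n) (c : ℕ), e i = c → ∃ q ∈ J, q.IsHomogeneous c ∧
      ∀ ν ∈ (q - X i ^ c).support, ν l ≠ 0 ∧ i ≠ l) (t : ℕ) :
    hilb J t ≤ (boundedExps e t).ncard := by
  classical
  let B : Submodule K (MvPolynomial (Fin n) K) :=
    Submodule.span K ((finite_boundedExps e t).toFinset.image fun α => monomial α (1 : K))
  have key : ∀ s : ℕ, ∀ ν : Fin n →₀ ℕ, ν.degree = t → t - ν l = s →
      monomial ν (1 : K) ∈ degPart J t ⊔ B := by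
    intro s
    induction s using Nat.strong_induction_on with
    | _ s ih =>
    intro ν hν hs
    by_cases hstd : ∀ i, (ν i : ℕ∞) < e i
    · refine Submodule.mem_sup_right (Submodule.subset_span ?_)
      simp only [Finset.coe_image, Set.Finite.coe_toFinset]
      exact ⟨ν, ⟨hν, hstd⟩, rfl⟩
    · push Not at hstd
      obtain ⟨i, hi⟩ := hstd
      obtain ⟨c, hc⟩ := ENat.ne_top_iff_exists.1 (ne_top_of_le_ne_top (ENat.natCast_ne_top _) hi)
      obtain ⟨q, hqJ, hqh, hq⟩ := hJ i c hc.symm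
      rw [← hc, Nat.cast_le] at hi
      have h3 : ν - Finsupp.single i c + Finsupp.single i c = ν :=
        tsub_add_cancel_of_le (Finsupp.single_le_iff.2 hi)
      set μ := ν - Finsupp.single i c with hμ
      have hμdeg : μ.degree + c = t := by
        have h4 := congrArg Finsupp.degree h3
        rw [map_add, Finsupp.degree_single] at h4
        omega
      have hr : (q - X i ^ c).IsHomogeneous c := hqh.sub (isHomogeneous_X_pow i c)
      have hdecomp : monomial ν (1 : K) = monomial μ 1 * q - monomial μ 1 * (q - X i ^ c) := by
        rw [mul_sub, sub_sub_cancel, MvPolynomial.X_pow_eq_monomial, monomial_mul, h3, one_mul]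
      rw [hdecomp]
      refine Submodule.sub_mem _ (Submodule.mem_sup_left ⟨Ideal.mul_mem_left _ _ hqJ, ?_⟩) ?_
      · have h5 := (isHomogeneous_monomial (1 : K) (d := μ) rfl).mul hqh
        rwa [hμdeg] at h5
      · rw [MvPolynomial.as_sum (q - X i ^ c), Finset.mul_sum]
        refine Submodule.sum_mem _ fun ρ hρ => ?_
        obtain ⟨h6, h7⟩ := hq ρ hρ
        have hρd : ρ.degree = c := by
          by_contra hne
          exact (mem_support_iff.1 hρ) (hr.coeff_eq_zero hne)
        rw [monomial_mul, one_mul]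
        have hsm : ∀ (κ : Fin n →₀ ℕ) (b : K), monomial κ b = b • monomial κ (1 : K) :=
          fun κ b => by rw [smul_monomial, smul_eq_mul, mul_one]
        rw [hsm]
        refine Submodule.smul_mem _ _ (ih _ ?_ (μ + ρ) (by rw [map_add, hρd, hμdeg]) rfl)
        have h8 : μ l = ν l := by
          rw [hμ, Finsupp.tsub_apply, Finsupp.single_eq_of_ne h7.symm]
          simp
        have h9 : (μ + ρ) l ≤ t := by
          rw [← hμdeg, ← hρd, ← map_add]
          exact Finsupp.le_degree l (μ + ρ)
        rw [Finsupp.add_apply] at h9 ⊢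
        omega
  have hle : homogeneousSubmodule (Fin n) K t ≤ degPart J t ⊔ B := by
    intro p hp
    rw [p.as_sum]
    refine Submodule.sum_mem _ fun ν hν => ?_
    have hνd : ν.degree = t := by
      by_contra hne
      exact (mem_support_iff.1 hν) (hp.coeff_eq_zero hne)
    have hsm : monomial ν (coeff ν p) = coeff ν p • monomial ν (1 : K) := by
      rw [smul_monomial, smul_eq_mul, mul_one]
    rw [hsm]
    exact Submodule.smul_mem _ _ (key _ ν hνd rfl)
  have h1 : FiniteDimensional K B := FiniteDimensional.span_finset K _
  have h2 := Submodule.finrank_mono hle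
  have h3 := Submodule.finrank_add_le_finrank_add_finrank (degPart J t) B
  have h4 : Module.finrank K B ≤ _ := finrank_span_finset_le_card _
  have h5 : _ ≤ (finite_boundedExps e t).toFinset.card := Finset.card_image_le
    (s := (finite_boundedExps e t).toFinset) (f := fun α => monomial α (1 : K))
  rw [← Set.ncard_eq_toFinset_card _ (finite_boundedExps e t)] at h5
  have h6 := hilb_add J t
  omega

lemma ncard_boundedExps_top_le {n : ℕ} {K : Type*} [Field K] (t : ℕ) :
    (boundedExps (fun _ : Fin n => ⊤) t).ncard ≤
      Module.finrank K (homogeneousSubmodule (Fin n) K t) := by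
  have hli : LinearIndependent K fun α : boundedExps (fun _ : Fin n => ⊤) t =>
      (⟨monomial α.1 1, isHomogeneous_monomial 1 α.2.1⟩ : homogeneousSubmodule (Fin n) K t) := by
    apply LinearIndependent.of_comp (homogeneousSubmodule (Fin n) K t).subtype
    exact (basisMonomials (Fin n) K).linearIndependent.comp _ Subtype.val_injective
  have : Fintype (boundedExps (fun _ : Fin n => ⊤) t) := (finite_boundedExps _ t).fintype
  rw [Set.ncard_eq_toFinset_card', Set.toFinset_card]
  exact hli.fintype_card_le_finrank

/-- The exponent bounds cut out by `X i ^ d i` for `i < r` and by `X l` for `l ≥ j`. -/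
def truncBound {n : ℕ} (d : Fin n → ℕ) (j r : ℕ) (i : Fin n) : ℕ∞ :=
  if i.val < r then d i else if j ≤ i.val then 1 else ⊤

lemma truncBound_succ {n : ℕ} (d : Fin n → ℕ) (j : ℕ) {r : ℕ} (hr : r < n) :
    truncBound d j (r + 1) = Function.update (truncBound d j r) ⟨r, hr⟩ (d ⟨r, hr⟩) := by
  funext i
  rcases eq_or_ne i ⟨r, hr⟩ with rfl | h
  · simp [truncBound]
  · rw [Function.update_of_ne h]
    have h1 : i.val ≠ r := fun h2 => h (Fin.ext h2)
    simp only [truncBound, show i.val < r + 1 ↔ i.val < r by omega]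

lemma truncBound_eq_update {n : ℕ} (d : Fin n → ℕ) {j r : ℕ} (hj : j < n) (hr : r ≤ j) :
    truncBound d j r = Function.update (truncBound d (j + 1) r) ⟨j, hj⟩ (1 : ℕ) := by
  funext i
  rcases eq_or_ne i ⟨j, hj⟩ with rfl | h
  · simp [truncBound, hr]
  · rw [Function.update_of_ne h]
    have h1 : i.val ≠ j := fun h2 => h (Fin.ext h2)
    simp only [truncBound, show j + 1 ≤ i.val ↔ j ≤ i.val by omega]

lemma truncBound_eq_top {n : ℕ} (d : Fin n → ℕ) {j r : ℕ} {i : Fin n} (hr : r ≤ i.val)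
    (hj : i.val < j) : truncBound d j r i = ⊤ := by
  rw [truncBound, if_neg (by omega), if_neg (by omega)]

/-- Generic forms are a regular sequence, numerically. -/
lemma hilb_truncIdeal_eq {F K : Type*} [Field F] [Field K] [Algebra F K]
    {n : ℕ} {d : Fin n → ℕ} {f : Fin n → MvPolynomial (Fin n) K} (hf : IsGenericSeq F d f)
    (hn : 0 < n) {j r : ℕ} (hrj : r ≤ j) (hjn : j ≤ n) (t : ℕ) :
    hilb (truncIdeal f j r) t = (boundedExps (truncBound d j r) t).ncard := by
  have hupper : ∀ j r t, hilb (truncIdeal f j r) t ≤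
      (boundedExps (truncBound d j r) t).ncard := by
    intro j r t
    refine (hilb_truncIdeal_le_of_generic hf (fun i => isHomogeneous_X_pow i (d i)) j r t).trans
      (hilb_le_ncard_boundedExps _ ⟨0, hn⟩ (fun i c hc => ⟨X i ^ c, ?_, isHomogeneous_X_pow i c,
        by simp⟩) t)
    rw [truncBound] at hc
    split_ifs at hc with h1 h2
    · rw [← Nat.cast_inj.1 hc]
      exact mem_truncIdeal (f := fun i : Fin n => (X i ^ d i : MvPolynomial (Fin n) K)) i h1
    · rw [← Nat.cast_inj.1 (Nat.cast_one.trans hc), pow_one]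
      exact X_mem_truncIdeal i h2
    · exact absurd hc (by simp)
  refine le_antisymm (hupper j r t) ?_
  have hstep : ∀ (J : Ideal (MvPolynomial (Fin n) K)) (e : Fin n → ℕ∞) (g : MvPolynomial (Fin n) K)
      (c : ℕ) (i : Fin n), IsGradedIdeal J → g.IsHomogeneous c → e i = ⊤ →
      (∀ t, hilb J t ≤ (boundedExps e t).ncard) → (∀ t, (boundedExps e t).ncard ≤ hilb J t) →
      ∀ t, (boundedExps (Function.update e i c) t).ncard ≤ hilb (J ⊔ Ideal.span {g}) t := by
    intro J e g c i hJ hg hi h1 h2 t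
    rcases lt_or_ge t c with h | h
    · rw [boundedExps_update_of_lt hi h, hilb_sup_span_singleton_of_lt hJ hg h]
      exact h2 t
    · have h3 := ncard_boundedExps_update hi (Nat.sub_add_cancel h)
      have h4 := hilb_le_sup_add hJ hg (Nat.sub_add_cancel h)
      have h5 := h2 t
      have h6 := h1 (t - c)
      omega
  induction r generalizing t with
  | zero =>
    clear hrj
    obtain ⟨s, hs⟩ : ∃ s, j + s = n := ⟨n - j, by omega⟩
    induction s generalizing j t with
    | zero =>
      have h1 : truncIdeal f j 0 = ⊥ := by
        rw [eq_bot_iff]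
        exact truncIdeal_le (fun i hi => by omega) fun l hl => by omega
      have h2 : truncBound d j 0 = fun _ => ⊤ := by
        funext i
        exact truncBound_eq_top d (Nat.zero_le _) (by omega)
      rw [h1, h2]
      refine (ncard_boundedExps_top_le (K := K) t).trans ?_
      have h3 := hilb_add (⊥ : Ideal (MvPolynomial (Fin n) K)) t
      have h4 : degPart (⊥ : Ideal (MvPolynomial (Fin n) K)) t = ⊥ := by
        rw [eq_bot_iff]
        intro p hp
        exact hp.1
      rw [h4, finrank_bot] at h3
      omega
    | succ s ih =>
      have hj : j < n := by omega
      rw [truncIdeal_eq_sup_X hj, truncBound_eq_update d hj (Nat.zero_le _)]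
      exact hstep _ _ _ _ _ (isGradedIdeal_truncIdeal hf.1 _ _) (isHomogeneous_X _ _)
        (truncBound_eq_top d (Nat.zero_le _) (Nat.lt_succ_self j)) (hupper _ _)
        (fun t => ih (by omega) t (by omega)) t
  | succ r ih =>
    have hr : r < n := by omega
    rw [truncIdeal_succ hr, truncBound_succ d j hr]
    exact hstep _ _ _ _ _ (isGradedIdeal_truncIdeal hf.1 _ _) (hf.1 ⟨r, hr⟩)
      (truncBound_eq_top d (i := ⟨r, hr⟩) le_rfl hrj) (hupper _ _) (fun t => ih (by omega) t) t

section Grid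

variable {n : ℕ} {K : Type*} [Field K]

/-- The exponent vectors `α` with `α i < d i` for `i < m` and `α i = 0` for `i ≥ m`. -/
def grid (d : Fin n → ℕ) (m : Fin n) : Set (Fin n →₀ ℕ) :=
  {α | ∀ i, (i < m → α i < d i) ∧ (m ≤ i → α i = 0)}

/-- The point of the affine chart `X m = 1` with nodes `a` indexed by `α`. -/
def gridPoint (m : Fin n) (a : Fin n → ℕ → K) (α : Fin n →₀ ℕ) (i : Fin n) : K :=
  if i < m then a i (α i) else if i = m then 1 else 0

/-- Homogenized Newton interpolation polynomials. -/
noncomputable def newtonForm (m : Fin n) (a : Fin n → ℕ → K) (β : Fin n →₀ ℕ) :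
    MvPolynomial (Fin n) K :=
  ∏ i, ∏ c ∈ Finset.range (β i), (X i - C (a i c) * X m)

lemma isHomogeneous_X_sub_C_mul_X (i m : Fin n) (b : K) :
    (X i - C b * X m : MvPolynomial (Fin n) K).IsHomogeneous 1 :=
  (isHomogeneous_X K i).sub (isHomogeneous_C_mul_X b m)

lemma isHomogeneous_prod_X_sub (i m : Fin n) (a : ℕ → K) (e : ℕ) :
    (∏ c ∈ Finset.range e, (X i - C (a c) * X m) : MvPolynomial (Fin n) K).IsHomogeneous e := by
  have h := IsHomogeneous.prod (Finset.range e)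
    (fun c => (X i - C (a c) * X m : MvPolynomial (Fin n) K)) (fun _ => 1)
    fun c _ => isHomogeneous_X_sub_C_mul_X i m (a c)
  simpa using h

lemma isHomogeneous_newtonForm (m : Fin n) (a : Fin n → ℕ → K) (β : Fin n →₀ ℕ) :
    (newtonForm m a β).IsHomogeneous β.degree := by
  rw [Finsupp.degree_eq_sum]
  exact IsHomogeneous.prod _ _ _ fun i _ => isHomogeneous_prod_X_sub i m (a i) (β i)

variable {d : Fin n → ℕ} {m : Fin n} {a : Fin n → ℕ → K}

lemma gridPoint_self (α : Fin n →₀ ℕ) : gridPoint m a α m = 1 := by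
  simp [gridPoint]

lemma eval_X_sub (α : Fin n →₀ ℕ) {i : Fin n} (hi : i < m) (b : K) :
    eval (gridPoint m a α) (X i - C b * X m) = a i (α i) - b := by
  simp [gridPoint, hi]

lemma eval_newtonForm_eq_zero (ha : ∀ i, Set.InjOn (a i) (Set.Iio (d i))) {α β : Fin n →₀ ℕ}
    (hα : α ∈ grid d m) (hβ : β ∈ grid d m) :
    eval (gridPoint m a α) (newtonForm m a β) = 0 ↔ ¬ β ≤ α := by
  rw [newtonForm, map_prod, Finset.prod_eq_zero_iff, Finsupp.le_def]
  push Not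
  refine exists_congr fun i => ?_
  rw [map_prod, Finset.prod_eq_zero_iff]
  simp only [Finset.mem_univ, true_and, Finset.mem_range]
  rcases lt_or_ge i m with hi | hi
  · constructor
    · rintro ⟨c, hc, h⟩
      rw [eval_X_sub α hi, sub_eq_zero] at h
      have h1 : c < d i := hc.trans ((hβ i).1 hi)
      rwa [ha i ((hα i).1 hi) h1 h]
    · intro h
      exact ⟨α i, h, by rw [eval_X_sub α hi, sub_self]⟩
  · rw [(hβ i).2 hi]
    simp

lemma finite_grid : (grid d m).Finite := by
  let b : Fin n →₀ ℕ := Finsupp.equivFunOnFinite.symm d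
  refine (Set.finite_Iic b).subset fun α hα i => ?_
  change α i ≤ d i
  rcases lt_or_ge i m with hi | hi
  · exact ((hα i).1 hi).le
  · rw [(hα i).2 hi]
    exact Nat.zero_le _

lemma grid_of_le {α β : Fin n →₀ ℕ} (hα : α ∈ grid d m) (h : β ≤ α) : β ∈ grid d m :=
  fun i => ⟨fun hi => (h i).trans_lt ((hα i).1 hi), fun hi => Nat.le_zero.1 ((hα i).2 hi ▸ h i)⟩

lemma exists_newton_multiple (ha : ∀ i, Set.InjOn (a i) (Set.Iio (d i))) {β : Fin n →₀ ℕ} {j : ℕ}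
    (hβ : β ∈ grid d m) (hβj : β.degree ≤ j) :
    ∃ u : MvPolynomial (Fin n) K, u.IsHomogeneous j ∧
      ∀ α ∈ grid d m, eval (gridPoint m a α) u = 0 ↔ ¬ β ≤ α := by
  refine ⟨newtonForm m a β * X m ^ (j - β.degree), ?_, fun α hα => ?_⟩
  · have h := (isHomogeneous_newtonForm m a β).mul (isHomogeneous_X_pow (R := K) m (j - β.degree))
    rwa [Nat.add_sub_cancel' hβj] at h
  · rw [map_mul, map_pow, eval_X, gridPoint_self, one_pow, mul_one]
    exact eval_newtonForm_eq_zero ha hα hβ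

lemma eq_of_le_of_degree_le {α β : Fin n →₀ ℕ} (h : β ≤ α) (hd : α.degree ≤ β.degree) :
    β = α := by
  have h1 : α - β + β = α := tsub_add_cancel_of_le h
  have h2 := congrArg Finsupp.degree h1
  rw [map_add] at h2
  have h3 : (α - β).degree = 0 := by omega
  rw [Finsupp.degree_eq_zero_iff] at h3
  rw [← h1, h3, zero_add]

/-- Forms of degree `j` interpolate arbitrary values at the grid points of level at most `j`. -/
lemma exists_interpolation (ha : ∀ i, Set.InjOn (a i) (Set.Iio (d i))) (j : ℕ)
    (φ : (Fin n →₀ ℕ) → K) (Z : Finset (Fin n →₀ ℕ)) (hZ : ∀ α ∈ Z, α ∈ grid d m)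
    (hZj : ∀ α ∈ Z, α.degree ≤ j) :
    ∃ u : MvPolynomial (Fin n) K, u.IsHomogeneous j ∧
      ∀ α ∈ Z, eval (gridPoint m a α) u = φ α := by
  classical
  induction Z using Finset.induction_on_max_value
      (fun α : Fin n →₀ ℕ => α.degree) with
  | empty => exact ⟨0, isHomogeneous_zero _ _ _, by simp⟩
  | insert β s hβ hmax ih =>
    obtain ⟨u, hu, hus⟩ := ih (fun α hα => hZ α (Finset.mem_insert_of_mem hα))
      (fun α hα => hZj α (Finset.mem_insert_of_mem hα))
    have hβg := hZ β (Finset.mem_insert_self _ _)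
    obtain ⟨v, hv, hvs⟩ := exists_newton_multiple ha hβg (hZj β (Finset.mem_insert_self _ _))
    have hv0 : eval (gridPoint m a β) v ≠ 0 := fun h => (hvs β hβg).1 h le_rfl
    refine ⟨u + C ((φ β - eval (gridPoint m a β) u) / eval (gridPoint m a β) v) * v,
      hu.add (hv.C_mul _), fun α hα => ?_⟩
    rw [map_add, map_mul, eval_C]
    rcases Finset.mem_insert.1 hα with rfl | hαs
    · rw [div_mul_cancel₀ _ hv0]
      ring
    · have h0 : eval (gridPoint m a α) v = 0 := by
        rw [hvs α (hZ α hα)]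
        intro hle
        rw [eq_of_le_of_degree_le hle (hmax α hαs)] at hβ
        exact hβ hαs
      rw [h0, mul_zero, add_zero, hus α hαs]

/-- Reflection of the grid. -/
noncomputable def gridRev (d : Fin n → ℕ) (m : Fin n) (α : Fin n →₀ ℕ) : Fin n →₀ ℕ :=
  Finsupp.equivFunOnFinite.symm fun i => if i < m then d i - 1 - α i else 0

/-- The level of the top corner of the grid. -/
def gridTop (d : Fin n → ℕ) (m : Fin n) : ℕ := ∑ i, if i < m then d i - 1 else 0

lemma gridRev_apply (α : Fin n →₀ ℕ) (i : Fin n) :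
    gridRev d m α i = if i < m then d i - 1 - α i else 0 := rfl

lemma gridRev_mem (hd : ∀ i, 1 ≤ d i) (α : Fin n →₀ ℕ) : gridRev d m α ∈ grid d m := by
  intro i
  rw [gridRev_apply]
  refine ⟨fun hi => ?_, fun hi => if_neg hi.not_gt⟩
  rw [if_pos hi]
  have := hd i
  omega

lemma gridRev_gridRev {α : Fin n →₀ ℕ} (hα : α ∈ grid d m) :
    gridRev d m (gridRev d m α) = α := by
  ext i
  rw [gridRev_apply, gridRev_apply]
  split_ifs with hi
  · have := (hα i).1 hi
    omega
  · exact ((hα i).2 (not_lt.1 hi)).symm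

lemma degree_gridRev {α : Fin n →₀ ℕ} (hα : α ∈ grid d m) :
    (gridRev d m α).degree + α.degree = gridTop d m := by
  rw [Finsupp.degree_eq_sum, Finsupp.degree_eq_sum, ← Finset.sum_add_distrib, gridTop]
  refine Finset.sum_congr rfl fun i _ => ?_
  rw [gridRev_apply]
  split_ifs with hi
  · have := (hα i).1 hi
    omega
  · rw [(hα i).2 (not_lt.1 hi)]

lemma exists_interpolation_rev (hd : ∀ i, 1 ≤ d i) (ha : ∀ i, Set.InjOn (a i) (Set.Iio (d i)))
    (j : ℕ) (φ : (Fin n →₀ ℕ) → K) (Z : Finset (Fin n →₀ ℕ)) (hZ : ∀ α ∈ Z, α ∈ grid d m)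
    (hZj : ∀ α ∈ Z, gridTop d m ≤ j + α.degree) :
    ∃ u : MvPolynomial (Fin n) K, u.IsHomogeneous j ∧
      ∀ α ∈ Z, eval (gridPoint m a α) u = φ α := by
  classical
  obtain ⟨u, hu, huZ⟩ := exists_interpolation (d := d) (m := m)
    (a := fun i c => a i (d i - 1 - c)) (fun i x hx y hy hxy => by
      have hx' : x < d i := hx
      have hy' : y < d i := hy
      have h1 := ha i (x₁ := d i - 1 - x) (x₂ := d i - 1 - y) (by simp only [Set.mem_Iio]; omega)
        (by simp only [Set.mem_Iio]; omega) hxy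
      omega) j (fun α => φ (gridRev d m α)) (Z.image (gridRev d m))
    (fun α hα => by
      obtain ⟨β, -, rfl⟩ := Finset.mem_image.1 hα
      exact gridRev_mem hd β)
    (fun α hα => by
      obtain ⟨β, hβ, rfl⟩ := Finset.mem_image.1 hα
      have h1 := hZj β hβ
      have h2 := degree_gridRev (hZ β hβ)
      omega)
  refine ⟨u, hu, fun α hα => ?_⟩
  have h := huZ _ (Finset.mem_image_of_mem _ hα)
  rw [gridRev_gridRev (hZ α hα)] at h
  rw [← h]
  congr 2
  funext i
  simp only [gridPoint, gridRev_apply]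
  split_ifs with hi
  · have := (hZ α hα i).1 hi
    congr 1
    omega
  · rfl
  · rfl

/-- A form of degree `e` vanishing exactly at the grid points of level less than `w ≤ e`. -/
lemma exists_form_level [Infinite K] (ha : ∀ i, Set.InjOn (a i) (Set.Iio (d i))) {w e : ℕ}
    (hwe : w ≤ e) :
    ∃ q : MvPolynomial (Fin n) K, q.IsHomogeneous e ∧
      ∀ α ∈ grid d m, (eval (gridPoint m a α) q = 0 ↔ α.degree < w) := by
  let V : Submodule K (MvPolynomial (Fin n) K) := homogeneousSubmodule (Fin n) K e ⊓
    ⨅ α : {α : Fin n →₀ ℕ // α ∈ grid d m ∧ α.degree < w},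
      LinearMap.ker (aeval (gridPoint m a α.1)).toLinearMap
  have hV : ∀ p, p ∈ V ↔ p.IsHomogeneous e ∧
      ∀ α ∈ grid d m, α.degree < w → eval (gridPoint m a α) p = 0 := by
    intro p
    simp only [V, Submodule.mem_inf, mem_homogeneousSubmodule, Submodule.mem_iInf,
      LinearMap.mem_ker, AlgHom.toLinearMap_apply, Subtype.forall, and_imp, aeval_eq_eval]
  have : Finite {α : Fin n →₀ ℕ // α ∈ grid d m ∧ w ≤ α.degree} :=
    Set.Finite.to_subtype (finite_grid.subset fun α hα => hα.1)
  obtain ⟨q, hqV, hq⟩ := Module.Dual.exists_forall_mem_ne_zero_of_forall_exists V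
    (fun α : {α : Fin n →₀ ℕ // α ∈ grid d m ∧ w ≤ α.degree} =>
      (aeval (gridPoint m a α.1)).toLinearMap) (by
      rintro ⟨α, hα, hwα⟩
      obtain ⟨β, hβα, hβ⟩ := Finsupp.exists_le_degree_eq α w hwα
      obtain ⟨u, hu, hu0⟩ := exists_newton_multiple ha (grid_of_le hα hβα) (hβ.le.trans hwe)
      refine ⟨u, (hV u).2 ⟨hu, fun γ hγ hγw => (hu0 γ hγ).2 fun hle => ?_⟩, ?_⟩
      · have := Finsupp.degree_mono hle
        omega
      · simp only [AlgHom.toLinearMap_apply, aeval_eq_eval]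
        exact fun h0 => (hu0 α hα).1 h0 hβα)
  obtain ⟨hqe, hq0⟩ := (hV q).1 hqV
  refine ⟨q, hqe, fun α hα => ⟨fun h => ?_, hq0 α hα⟩⟩
  by_contra hw
  apply hq ⟨α, hα, not_lt.1 hw⟩
  simpa only [AlgHom.toLinearMap_apply, aeval_eq_eval] using h

end Grid

lemma exists_prod_X_sub_eq {n : ℕ} {K : Type*} [Field K] (i m : Fin n) (b : ℕ → K) (e : ℕ) :
    ∃ r : MvPolynomial (Fin n) K,
      ∏ c ∈ Finset.range e, (X i - C (b c) * X m) = X i ^ e + X m * r := by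
  induction e with
  | zero => exact ⟨0, by simp⟩
  | succ e ih =>
    obtain ⟨r, hr⟩ := ih
    refine ⟨r * (X i - C (b e) * X m) - C (b e) * X i ^ e, ?_⟩
    rw [Finset.prod_range_succ, hr]
    ring

lemma finrank_degPart_add_card_le {n : ℕ} {K ι : Type*} [Field K] [Fintype ι]
    {J₀ J : Ideal (MvPolynomial (Fin n) K)} (hle : J₀ ≤ J) (t : ℕ) (P : ι → Fin n → K)
    (h0 : ∀ p ∈ J₀, ∀ i, eval (P i) p = 0)
    (hsurj : ∀ φ : ι → K, ∃ p ∈ degPart J t, ∀ i, eval (P i) p = φ i) :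
    hilb J t + Fintype.card ι ≤ hilb J₀ t := by
  obtain ⟨L, hL⟩ : ∃ L : degPart J t →ₗ[K] (ι → K), ∀ p i, L p i = eval (P i) p.1 :=
    ⟨{  toFun := fun p i => eval (P i) p.1
        map_add' := fun p q => funext fun i => by
          rw [Submodule.coe_add, map_add, Pi.add_apply]
        map_smul' := fun c p => funext fun i => by
          rw [Submodule.coe_smul, smul_eval, Pi.smul_apply, RingHom.id_apply, smul_eq_mul] },
      fun _ _ => rfl⟩
  have hrange : LinearMap.range L = ⊤ := by
    rw [LinearMap.range_eq_top]
    intro φ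
    obtain ⟨p, hp, hpφ⟩ := hsurj φ
    refine ⟨⟨p, hp⟩, funext fun i => ?_⟩
    rw [hL, hpφ]
  have h1 := LinearMap.finrank_range_add_finrank_ker L
  rw [hrange, finrank_top, Module.finrank_fintype_fun_eq_card] at h1
  have h2 : Module.finrank K (degPart J₀ t) ≤ Module.finrank K (LinearMap.ker L) := by
    let N : degPart J₀ t →ₗ[K] LinearMap.ker L :=
      (Submodule.inclusion (degPart_mono hle t)).codRestrict (LinearMap.ker L) fun p => by
        rw [LinearMap.mem_ker]
        funext i
        rw [hL]
        exact h0 p.1 p.2.1 i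
    refine LinearMap.finrank_le_finrank_of_injective (f := N) fun x y hxy => ?_
    have h3 : (N x).1.1 = (N y).1.1 := by rw [hxy]
    exact Subtype.ext h3
  have h3 := hilb_add J t
  have h4 := hilb_add J₀ t
  omega

/-- A special sequence whose Hilbert function is bounded by counting grid points. -/
lemma exists_special_forms {n : ℕ} {K : Type*} [Field K] [Infinite K] {d : Fin n → ℕ}
    (hd : ∀ i, 1 ≤ d i) (m : Fin n) (hm : m.val + 1 < n) {t w : ℕ} (hw : w ≤ d m)
    (hwt : w + d ⟨m.val + 1, hm⟩ ≤ t + 1 ∨ w = 0) :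
    ∃ g : Fin n → MvPolynomial (Fin n) K, (∀ i, (g i).IsHomogeneous (d i)) ∧
      hilb (truncIdeal g (m.val + 1) (m.val + 2)) t +
        {α ∈ grid d m | α.degree < w ∨ gridTop d m + d m ≤ t + α.degree}.ncard ≤
      (boundedExps (truncBound d (m.val + 1) m.val) t).ncard := by
  classical
  let a : Fin n → ℕ → K := fun _ => Infinite.natEmbedding K
  have ha : ∀ i, Set.InjOn (a i) (Set.Iio (d i)) :=
    fun i => (Infinite.natEmbedding K).injective.injOn
  obtain ⟨q, hqh, hq⟩ := exists_form_level (m := m) ha hw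
  let m' : Fin n := ⟨m.val + 1, hm⟩
  let g : Fin n → MvPolynomial (Fin n) K := fun i =>
    if i < m then ∏ c ∈ Finset.range (d i), (X i - C (a i c) * X m)
    else if i = m then q else X m ^ d i
  have hgh : ∀ i, (g i).IsHomogeneous (d i) := by
    intro i
    simp only [g]
    split_ifs with h1 h2
    · exact isHomogeneous_prod_X_sub i m (a i) (d i)
    · rwa [h2]
    · exact isHomogeneous_X_pow m (d i)
  have hgm : g m = q := by simp [g]
  have hgm' : g m' = X m ^ d m' := by
    have h1 : ¬ m' < m := by simp [m', Fin.lt_def]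
    have h2 : m' ≠ m := fun h => by simpa [m'] using congrArg Fin.val h
    simp only [g, if_neg h1, if_neg h2]
  refine ⟨g, hgh, ?_⟩
  set S := {α ∈ grid d m | α.degree < w ∨ gridTop d m + d m ≤ t + α.degree}
  have hSfin : S.Finite := finite_grid.subset fun α hα => hα.1
  let _ : Fintype S := hSfin.fintype
  have hupper : hilb (truncIdeal g (m.val + 1) m.val) t ≤
      (boundedExps (truncBound d (m.val + 1) m.val) t).ncard := by
    refine hilb_le_ncard_boundedExps _ m (fun i c hc => ?_) t
    rw [truncBound] at hc
    split_ifs at hc with h1 h2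
    · obtain rfl := Nat.cast_inj.1 hc
      refine ⟨g i, mem_truncIdeal i h1, hgh i, fun ν hν => ?_⟩
      have him : i < m := h1
      obtain ⟨r, hr⟩ := exists_prod_X_sub_eq i m (a i) (d i)
      simp only [g, if_pos him, hr, add_sub_cancel_left] at hν
      refine ⟨fun h => ?_, him.ne⟩
      rw [mem_support_iff, coeff_X_mul', if_neg (by simpa using h)] at hν
      exact hν rfl
    · obtain rfl := Nat.cast_inj.1 (Nat.cast_one.trans hc)
      exact ⟨X i, X_mem_truncIdeal i h2, isHomogeneous_X K i, by simp⟩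
    · exact absurd hc (by simp)
  refine le_trans ?_ hupper
  rw [← Nat.card_coe_set_eq, Nat.card_eq_fintype_card]
  refine finrank_degPart_add_card_le (truncIdeal_mono (by omega)) t
    (fun α : S => gridPoint m a α.1) ?_ ?_
  · intro p hp α
    have hle : truncIdeal g (m.val + 1) m.val ≤ RingHom.ker (eval (gridPoint m a α.1)) := by
      refine truncIdeal_le (fun i hi => ?_) fun l hl => ?_
      · have him : i < m := hi
        rw [RingHom.mem_ker]
        simp only [g, if_pos him, map_prod]
        refine Finset.prod_eq_zero (Finset.mem_range.2 ((α.2.1 i).1 him)) ?_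
        rw [eval_X_sub _ him, sub_self]
      · have h1 : ¬ l < m := by rw [Fin.lt_def]; omega
        have h2 : l ≠ m := by rintro rfl; omega
        rw [RingHom.mem_ker, eval_X, gridPoint, if_neg h1, if_neg h2]
    exact hle hp
  · intro φ
    let ψ : (Fin n →₀ ℕ) → K := fun α => if h : α ∈ S then φ ⟨α, h⟩ else 0
    obtain ⟨p, hp, hpw⟩ : ∃ p ∈ degPart (truncIdeal g (m.val + 1) (m.val + 2)) t,
        ∀ α ∈ grid d m, α.degree < w → eval (gridPoint m a α) p = ψ α := by
      rcases hwt with h | rfl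
      · rcases Nat.eq_zero_or_pos w with rfl | hw0
        · exact ⟨0, Submodule.zero_mem _, by simp⟩
        · obtain ⟨v, hv, hvφ⟩ := exists_interpolation (m := m) ha (t - d m') ψ
            ((finite_grid (d := d) (m := m)).toFinset.filter fun α => α.degree < w)
            (fun α hα => by simpa using (Finset.mem_filter.1 hα).1) (fun α hα => by
              have h1 := (Finset.mem_filter.1 hα).2
              have h2 : w + d m' ≤ t + 1 := h
              omega)
          refine ⟨v * g m', ⟨Ideal.mul_mem_left _ _ (mem_truncIdeal m' (by simp [m'])), ?_⟩,
            fun α hα hαw => ?_⟩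
          · have h1 := IsHomogeneous.mul hv (hgh m')
            have h2 : w + d m' ≤ t + 1 := h
            rwa [Nat.sub_add_cancel (by omega)] at h1
          · rw [map_mul, hgm', map_pow, eval_X, gridPoint_self, one_pow, mul_one]
            exact hvφ α (by simp [hα, hαw])
      · exact ⟨0, Submodule.zero_mem _, by simp⟩
    obtain ⟨u, hu, huφ⟩ : ∃ u ∈ degPart (truncIdeal g (m.val + 1) (m.val + 2)) t,
        ∀ α ∈ grid d m, (α.degree < w → eval (gridPoint m a α) u = 0) ∧
          (w ≤ α.degree → gridTop d m + d m ≤ t + α.degree →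
            eval (gridPoint m a α) u = ψ α - eval (gridPoint m a α) p) := by
      rcases lt_or_ge t (d m) with h | h
      · refine ⟨0, Submodule.zero_mem _, fun α hα => ⟨by simp, fun _ h1 => ?_⟩⟩
        have := degree_gridRev hα
        omega
      · obtain ⟨v, hv, hvφ⟩ := exists_interpolation_rev (m := m) hd ha (t - d m)
          (fun α => (ψ α - eval (gridPoint m a α) p) / eval (gridPoint m a α) q)
          ((finite_grid (d := d) (m := m)).toFinset.filter
            fun α => gridTop d m + d m ≤ t + α.degree)
          (fun α hα => by simpa using (Finset.mem_filter.1 hα).1) (fun α hα => by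
            have h1 := (Finset.mem_filter.1 hα).2
            omega)
        refine ⟨v * g m, ⟨Ideal.mul_mem_left _ _ (mem_truncIdeal m (by omega)), ?_⟩,
          fun α hα => ⟨fun hαw => ?_, fun hαw hαt => ?_⟩⟩
        · have h1 := IsHomogeneous.mul hv (hgh m)
          rwa [Nat.sub_add_cancel h] at h1
        · rw [map_mul, hgm, (hq α hα).2 hαw, mul_zero]
        · rw [map_mul, hgm, hvφ α (by simp [hα, hαt]), div_mul_cancel₀]
          exact fun h0 => (not_lt.2 hαw) ((hq α hα).1 h0)
    refine ⟨u + p, Submodule.add_mem _ hu hp, fun ⟨α, hα⟩ => ?_⟩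
    have hψ : φ ⟨α, hα⟩ = ψ α := by simp only [ψ, dif_pos hα]
    rw [hψ, map_add]
    rcases lt_or_ge α.degree w with h | h
    · rw [(huφ α hα.1).1 h, zero_add, hpw α hα.1 h]
    · rw [(huφ α hα.1).2 h (hα.2.resolve_left (not_lt.2 h)), sub_add_cancel]

section Count

variable {n : ℕ} {d : Fin n → ℕ} {m : Fin n}

lemma ncard_grid_degree_le (t : ℕ) :
    {α ∈ grid d m | α.degree ≤ t}.ncard =
      (boundedExps (truncBound d (m.val + 1) m.val) t).ncard := by
  refine Set.ncard_congr (fun α _ => α + Finsupp.single m (t - α.degree)) ?_ ?_ ?_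
  · rintro α ⟨hα, hαt⟩
    refine ⟨by rw [map_add, Finsupp.degree_single]; omega, fun i => ?_⟩
    rcases lt_trichotomy i m with hi | rfl | hi
    · rw [truncBound, if_pos (Fin.lt_def.1 hi), Finsupp.add_apply, Finsupp.single_eq_of_ne hi.ne, add_zero]
      exact Nat.cast_lt.2 ((hα i).1 hi)
    · rw [truncBound_eq_top d le_rfl (Nat.lt_succ_self _)]
      exact ENat.natCast_lt_top _
    · have h1 : m.val < i.val := hi
      rw [truncBound, if_neg (by omega), if_pos (by omega), Finsupp.add_apply,
        Finsupp.single_eq_of_ne hi.ne', add_zero, (hα i).2 hi.le]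
      simp
  · rintro α β ⟨hα, -⟩ ⟨hβ, -⟩ h
    ext i
    rcases lt_or_ge i m with hi | hi
    · have h1 := DFunLike.congr_fun h i
      simpa [Finsupp.single_eq_of_ne hi.ne] using h1
    · rw [(hα i).2 hi, (hβ i).2 hi]
  · rintro β ⟨hβt, hβ⟩
    have hdeg : (β.erase m).degree + β m = t := by
      rw [← hβt]
      conv_rhs => rw [← Finsupp.erase_add_single m β]
      rw [map_add, Finsupp.degree_single]
    refine ⟨β.erase m, ⟨fun i => ⟨fun hi => ?_, fun hi => ?_⟩, by omega⟩, ?_⟩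
    · have h1 := hβ i
      rw [truncBound, if_pos (Fin.lt_def.1 hi)] at h1
      rw [Finsupp.erase_ne hi.ne]
      exact Nat.cast_lt.1 h1
    · rcases hi.eq_or_lt with rfl | hi
      · exact Finsupp.erase_same
      · have h1 := hβ i
        have h2 : m.val < i.val := hi
        rw [truncBound, if_neg (by omega), if_pos (by omega)] at h1
        rw [Finsupp.erase_ne hi.ne']
        exact Nat.lt_one_iff.1 (by exact_mod_cast h1)
    · rw [show t - (β.erase m).degree = β m by omega]
      exact Finsupp.erase_add_single m β

lemma ncard_grid_le_degree (hd : ∀ i, 1 ≤ d i) {t u c : ℕ} (h : u + c = t) :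
    {α ∈ grid d m | gridTop d m + c ≤ t + α.degree}.ncard =
      (boundedExps (truncBound d (m.val + 1) m.val) u).ncard := by
  rw [← ncard_grid_degree_le]
  refine Set.ncard_congr (fun α _ => gridRev d m α) ?_ ?_ ?_
  · rintro α ⟨hα, hαt⟩
    have := degree_gridRev hα
    exact ⟨gridRev_mem hd α, by omega⟩
  · rintro α β ⟨hα, -⟩ ⟨hβ, -⟩ h
    rw [← gridRev_gridRev hα, h, gridRev_gridRev hβ]
  · rintro β ⟨hβ, hβt⟩
    have := degree_gridRev hβ
    exact ⟨gridRev d m β, ⟨gridRev_mem hd β, by omega⟩, gridRev_gridRev hβ⟩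

/-- The first difference of the Hilbert function of a complete intersection bounds that of the
special forms. -/
lemma ncard_boundedExps_le_of_disjoint (hd : ∀ i, 1 ≤ d i) (hm : m.val + 1 < n) {s t w H : ℕ}
    (hs : s + 1 = t) (hw : t + 1 = w + d ⟨m.val + 1, hm⟩ ∨ (w = 0 ∧ t < d ⟨m.val + 1, hm⟩))
    (hdisj : w = 0 ∨ t + w ≤ gridTop d m + d m)
    (hH : H + {α ∈ grid d m | α.degree < w ∨ gridTop d m + d m ≤ t + α.degree}.ncard ≤
      (boundedExps (truncBound d (m.val + 1) m.val) t).ncard) :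
    (boundedExps (truncBound d (m.val + 2) (m.val + 2)) s).ncard + H ≤
      (boundedExps (truncBound d (m.val + 2) (m.val + 2)) t).ncard := by
  set e := d ⟨m.val + 1, hm⟩ with he
  let N : ℕ → ℕ := fun j => (boundedExps (truncBound d (m.val + 1) m.val) j).ncard
  let c : ℕ → ℕ := fun j => (boundedExps (truncBound d (m.val + 1) (m.val + 1)) j).ncard
  let B : ℕ → ℕ := fun j => (boundedExps (truncBound d (m.val + 2) (m.val + 1)) j).ncard
  let h : ℕ → ℕ := fun j => (boundedExps (truncBound d (m.val + 2) (m.val + 2)) j).ncard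
  have hNtop : truncBound d (m.val + 1) m.val m = ⊤ := truncBound_eq_top d le_rfl (by omega)
  have hBtop : truncBound d (m.val + 2) (m.val + 1) ⟨m.val + 1, hm⟩ = ⊤ :=
    truncBound_eq_top d le_rfl (by simp)
  have hcN : ∀ u j, u + d m = j → N j = c j + N u := fun u j hj => by
    simp only [N, c, truncBound_succ d _ m.2]
    exact ncard_boundedExps_update hNtop hj
  have hcN' : ∀ j, j < d m → c j = N j := fun j hj => by
    simp only [N, c, truncBound_succ d _ m.2]
    exact congrArg Set.ncard (boundedExps_update_of_lt hNtop hj)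
  have hcB : ∀ u j, u + 1 = j → B j = c j + B u := fun u j hj => by
    simp only [B, c, truncBound_eq_update d hm le_rfl]
    exact ncard_boundedExps_update hBtop hj
  have hcB0 : c 0 = B 0 := by
    simp only [B, c, truncBound_eq_update d hm le_rfl]
    exact congrArg Set.ncard (boundedExps_update_of_lt hBtop Nat.one_pos)
  have hhB : ∀ u j, u + e = j → B j = h j + B u := fun u j hj => by
    simp only [B, h, truncBound_succ d _ hm]
    exact ncard_boundedExps_update hBtop hj
  have hhB' : ∀ j, j < e → h j = B j := fun j hj => by
    simp only [B, h, truncBound_succ d _ hm]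
    exact congrArg Set.ncard (boundedExps_update_of_lt hBtop hj)
  have hcle : ∀ j, c j ≤ N j := fun j => by
    rcases lt_or_ge j (d m) with hj | hj
    · exact (hcN' j hj).le
    · have := hcN (j - d m) j (by omega)
      omega
  have hcount : {α ∈ grid d m | α.degree < w ∨ gridTop d m + d m ≤ t + α.degree}.ncard =
      {α ∈ grid d m | α.degree < w}.ncard +
        {α ∈ grid d m | gridTop d m + d m ≤ t + α.degree}.ncard := by
    rw [← Set.ncard_union_eq _ (finite_grid.subset fun _ h => h.1)
      (finite_grid.subset fun _ h => h.1)]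
    · congr 1
      ext α
      simp only [Set.mem_ofPred_eq, Set.mem_union]
      tauto
    · rw [Set.disjoint_left]
      rintro α ⟨-, h1⟩ ⟨-, h2⟩
      omega
  have htop : c t + {α ∈ grid d m | gridTop d m + d m ≤ t + α.degree}.ncard = N t := by
    rcases lt_or_ge t (d m) with ht | ht
    · have h0 : {α ∈ grid d m | gridTop d m + d m ≤ t + α.degree} = ∅ := by
        rw [Set.eq_empty_iff_forall_notMem]
        rintro α ⟨hα, h1⟩
        have := degree_gridRev hα
        omega
      rw [h0, Set.ncard_empty, add_zero, hcN' t ht]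
    · rw [ncard_grid_le_degree hd (show t - d m + d m = t by omega)]
      exact (hcN _ _ (by omega)).symm
  change h s + H ≤ h t
  rcases hw with hw | ⟨rfl, hw⟩
  · rcases Nat.eq_zero_or_pos w with rfl | hw0
    · have h1 := hcB s t hs
      have h2 := hhB' t (by omega)
      have h3 := hhB' s (by omega)
      have h4 : N t = (boundedExps (truncBound d (m.val + 1) m.val) t).ncard := rfl
      omega
    · have h1 := ncard_grid_degree_le (d := d) (m := m) (w - 1)
      have h2 : {α ∈ grid d m | α.degree < w} = {α ∈ grid d m | α.degree ≤ w - 1} := by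
        ext α
        simp only [Set.mem_ofPred_eq]
        exact and_congr_right fun _ => by omega
      rw [← h2] at h1
      have h3 := hcB s t hs
      have h4 := hhB (w - 1) t (by omega)
      have h5 : N t = (boundedExps (truncBound d (m.val + 1) m.val) t).ncard := rfl
      have h6 : N (w - 1) = (boundedExps (truncBound d (m.val + 1) m.val) (w - 1)).ncard := rfl
      have h7 := hcle (w - 1)
      rcases Nat.eq_zero_or_pos (w - 1) with hw1 | hw1
      · have h8 := hhB' s (by omega)
        rw [hw1] at h4 h7 h6 h1
        omega
      · have h8 := hhB (w - 2) s (by omega)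
        have h9 := hcB (w - 2) (w - 1) (by omega)
        omega
  · have h1 := hcB s t hs
    have h2 := hhB' t hw
    have h3 := hhB' s (by omega)
    have h4 : N t = (boundedExps (truncBound d (m.val + 1) m.val) t).ncard := rfl
    omega

end Count

lemma exists_notMem_of_hilb_ne_zero {σ K : Type*} [Field K]
    {J : Ideal (MvPolynomial σ K)} {t : ℕ} (h : hilb J t ≠ 0) :
    ∃ v : MvPolynomial σ K, v.IsHomogeneous t ∧ v ∉ J := by
  by_contra! hcon
  have h1 : degPart J t = homogeneousSubmodule σ K t :=
    le_antisymm (degPart_le J t) fun p hp => ⟨hcon p hp, hp⟩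
  rw [hilb, h1, Nat.sub_self] at h
  exact h rfl

lemma hilb_zero_le_one {σ K : Type*} [Field K] (J : Ideal (MvPolynomial σ K)) :
    hilb J 0 ≤ 1 := by
  refine (Nat.sub_le _ _).trans (finrank_le_one ⟨1, isHomogeneous_one σ K⟩ fun p => ?_)
  refine ⟨coeff 0 p.1, Subtype.ext ?_⟩
  have h := totalDegree_eq_zero_iff_eq_C.1 (Nat.le_zero.1 (IsHomogeneous.totalDegree_le p.2))
  rw [Submodule.coe_smul, smul_eq_C_mul, mul_one]
  exact h.symm

section Key

variable {F K : Type*} [Field F] [Field K] [Algebra F K] {n : ℕ} {d : Fin n → ℕ}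
  {f : Fin n → MvPolynomial (Fin n) K}

lemma hilb_eq_zero_or_add_le_succ (hf : IsGenericSeq F d f) {j r s t : ℕ} (hst : s + 1 = t)
    (hr : r < n) (ht : t ≤ d ⟨r, hr⟩)
    (h : hilb (truncIdeal f j r) t = 0 ∨
      hilb (truncIdeal f (j + 1) r) s + hilb (truncIdeal f j r) t ≤
        hilb (truncIdeal f (j + 1) r) t) :
    hilb (truncIdeal f j (r + 1)) t = 0 ∨
      hilb (truncIdeal f (j + 1) (r + 1)) s + hilb (truncIdeal f j (r + 1)) t ≤
        hilb (truncIdeal f (j + 1) (r + 1)) t := by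
  have hgr := fun j => isGradedIdeal_truncIdeal hf.1 j r
  rcases eq_or_ne (hilb (truncIdeal f j r) t) 0 with h0 | h0
  · left
    have := hilb_anti (truncIdeal_mono (f := f) (j := j) (Nat.le_add_right r 1)) t
    omega
  right
  have h1 := h.resolve_left h0
  have hs : hilb (truncIdeal f (j + 1) (r + 1)) s = hilb (truncIdeal f (j + 1) r) s := by
    rw [truncIdeal_succ hr]
    exact hilb_sup_span_singleton_of_lt (hgr _) (hf.1 _) (by omega)
  rcases ht.lt_or_eq with ht | ht
  · have h2 : ∀ j, hilb (truncIdeal f j (r + 1)) t = hilb (truncIdeal f j r) t := fun j => by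
      rw [truncIdeal_succ hr]
      exact hilb_sup_span_singleton_of_lt (hgr _) (hf.1 _) ht
    rw [hs, h2, h2]
    exact h1
  · obtain ⟨v, hv, hvI⟩ := exists_notMem_of_hilb_ne_zero h0
    have h2 := hilb_le_sup_add (hgr (j + 1)) (hf.1 ⟨r, hr⟩) (show 0 + d ⟨r, hr⟩ = t by omega)
    have h3 := hilb_zero_le_one (truncIdeal f (j + 1) r)
    rw [← truncIdeal_succ hr] at h2
    let g : Fin n → MvPolynomial (Fin n) K := Function.update f ⟨r, hr⟩ v
    have hg : ∀ i, (g i).IsHomogeneous (d i) := by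
      intro i
      rcases eq_or_ne i ⟨r, hr⟩ with rfl | hi
      · simp only [g, Function.update_self]
        rwa [← ht]
      · simp only [g, Function.update_of_ne hi]
        exact hf.1 i
    have hgle : truncIdeal f j r ⊔ Ideal.span {v} ≤ truncIdeal g j (r + 1) := by
      refine sup_le (truncIdeal_le (fun i hi => ?_) fun l hl => X_mem_truncIdeal l hl) ?_
      · have hi' : i ≠ ⟨r, hr⟩ := fun h => by simp [h] at hi
        have h4 : g i = f i := Function.update_of_ne hi' _ _
        rw [← h4]
        exact mem_truncIdeal i (by omega)
      · rw [Ideal.span_singleton_le_iff_mem]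
        have h4 : g ⟨r, hr⟩ = v := Function.update_self ..
        rw [← h4]
        exact mem_truncIdeal _ (Nat.lt_succ_self r)
    have h4 := hilb_truncIdeal_le_of_generic hf hg j (r + 1) t
    have h5 := hilb_sup_lt hv hvI
    have h6 : hilb (truncIdeal g j (r + 1)) t ≤ hilb (truncIdeal f j r ⊔ Ideal.span {v}) t := by
      refine le_of_eq (congrArg (fun J => hilb J t) (le_antisymm ?_ hgle))
      refine truncIdeal_le (fun i hi => ?_) fun l hl => Ideal.mem_sup_left (X_mem_truncIdeal l hl)
      rcases eq_or_ne i ⟨r, hr⟩ with rfl | hi'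
      · simp only [g, Function.update_self]
        exact Ideal.mem_sup_right (Ideal.mem_span_singleton_self v)
      · simp only [g, Function.update_of_ne hi']
        have h7 : i.val ≠ r := fun h => hi' (Fin.ext h)
        exact Ideal.mem_sup_left (mem_truncIdeal i (by omega))
    omega

lemma hilb_eq_zero_or_add_le (hf : IsGenericSeq F d f) [Infinite K] (hd : ∀ i, 1 ≤ d i)
    (m : Fin n) (hm : m.val + 1 < n) (hC : gridTop d m ≤ d m + d ⟨m.val + 1, hm⟩)
    {s t : ℕ} (hst : s + 1 = t) :
    hilb (truncIdeal f (m.val + 1) (m.val + 2)) t = 0 ∨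
      (2 * t + 2 ≤ gridTop d m + d m + d ⟨m.val + 1, hm⟩ ∧
        hilb (truncIdeal f (m.val + 2) (m.val + 2)) s +
          hilb (truncIdeal f (m.val + 1) (m.val + 2)) t ≤
            hilb (truncIdeal f (m.val + 2) (m.val + 2)) t) := by
  by_cases ht : 2 * t + 2 ≤ gridTop d m + d m + d ⟨m.val + 1, hm⟩
  · refine Or.inr ⟨ht, ?_⟩
    obtain ⟨g, hg, hgt⟩ := exists_special_forms (K := K) hd m hm (t := t)
      (w := t + 1 - d ⟨m.val + 1, hm⟩) (by omega) (by omega)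
    have h1 := ncard_boundedExps_le_of_disjoint hd hm hst
      (w := t + 1 - d ⟨m.val + 1, hm⟩) (by omega) (by omega) hgt
    rw [hilb_truncIdeal_eq hf (by omega) le_rfl (by omega),
      hilb_truncIdeal_eq hf (by omega) le_rfl (by omega)]
    have h2 := hilb_truncIdeal_le_of_generic hf hg (m.val + 1) (m.val + 2) t
    omega
  · left
    obtain ⟨g, hg, hgt⟩ := exists_special_forms (K := K) hd m hm (t := t)
      (w := min (t + 1 - d ⟨m.val + 1, hm⟩) (d m)) (by omega) (by omega)
    have h2 := hilb_truncIdeal_le_of_generic hf hg (m.val + 1) (m.val + 2) t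
    rw [← ncard_grid_degree_le] at hgt
    have h3 : {α ∈ grid d m | α.degree ≤ t}.ncard ≤
        {α ∈ grid d m | α.degree < min (t + 1 - d ⟨m.val + 1, hm⟩) (d m) ∨
          gridTop d m + d m ≤ t + α.degree}.ncard := by
      refine Set.ncard_le_ncard ?_ (finite_grid.subset fun _ h => h.1)
      rintro α ⟨hα, -⟩
      refine ⟨hα, ?_⟩
      omega
    omega

/-- Either every form of degree `t` vanishes in the quotient by the larger ideal, or the next
variable acts injectively in degree `t - 1`. -/
lemma mem_truncIdeal_or_injective (hf : IsGenericSeq F d f) [Infinite K] (hd : ∀ i, 1 ≤ d i)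
    (hmono : Monotone d) (m : Fin n) (hm : m.val + 1 < n)
    (hC : gridTop d m ≤ d m + d ⟨m.val + 1, hm⟩)
    (hC' : ∀ i : Fin n, i.val = m.val + 2 →
      gridTop d m + d m + d ⟨m.val + 1, hm⟩ ≤ 2 * d i + 3) {s t : ℕ} (hst : s + 1 = t) :
    (∀ p : MvPolynomial (Fin n) K, p.IsHomogeneous t → p ∈ truncIdeal f (m.val + 1) n) ∨
      ∀ q : MvPolynomial (Fin n) K, q.IsHomogeneous s →
        q * X ⟨m.val + 1, hm⟩ ∈ truncIdeal f (m.val + 2) n → q ∈ truncIdeal f (m.val + 2) n := by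
  have hind : ∀ r, m.val + 2 ≤ r → r ≤ n → hilb (truncIdeal f (m.val + 1) r) t = 0 ∨
      hilb (truncIdeal f (m.val + 2) r) s + hilb (truncIdeal f (m.val + 1) r) t ≤
        hilb (truncIdeal f (m.val + 2) r) t := by
    rcases hilb_eq_zero_or_add_le hf hd m hm hC hst with h | ⟨ht, h⟩
    · intro r hr hrn
      left
      have := hilb_anti (truncIdeal_mono (f := f) (j := m.val + 1) hr) t
      omega
    · intro r hr
      induction r, hr using Nat.le_induction with
      | base => exact fun _ => Or.inr h
      | succ r hr ih =>
        intro hrn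
        refine hilb_eq_zero_or_add_le_succ hf hst hrn ?_ (ih (by omega))
        have h1 := hC' ⟨m.val + 2, by omega⟩ rfl
        have h2 : d ⟨m.val + 2, by omega⟩ ≤ d ⟨r, hrn⟩ := hmono hr
        omega
  rcases hind n (by omega) le_rfl with h | h
  · exact Or.inl fun p hp => le_of_hilb_eq_zero h hp
  · refine Or.inr fun q hq hqX => ?_
    refine mem_of_mul_mem_of_hilb_le (isGradedIdeal_truncIdeal hf.1 _ n) (isHomogeneous_X K _)
      hst ?_ hq hqX
    rwa [← truncIdeal_eq_sup_X hm]

end Key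

section Degrees

variable {n : ℕ} {d : Fin n → ℕ}

/-- The sum of the first `i` degrees. -/
def partialSum (d : Fin n → ℕ) (i : ℕ) : ℕ :=
  ∑ j ∈ Finset.univ.filter (fun j : Fin n => (j : ℕ) < i), d j

lemma partialSum_zero (d : Fin n → ℕ) : partialSum d 0 = 0 := by
  simp [partialSum]

lemma partialSum_succ (d : Fin n → ℕ) {i : ℕ} (hi : i < n) :
    partialSum d (i + 1) = partialSum d i + d ⟨i, hi⟩ := by
  have h : Finset.univ.filter (fun j : Fin n => (j : ℕ) < i + 1) =
      insert ⟨i, hi⟩ (Finset.univ.filter fun j : Fin n => (j : ℕ) < i) := by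
    ext j
    simp only [Finset.mem_filter, Finset.mem_univ, true_and, Finset.mem_insert, Fin.ext_iff]
    omega
  rw [partialSum, h, Finset.sum_insert (by simp), add_comm]
  rfl

lemma partialSum_le (hmono : Monotone d) (m : Fin n) {i : ℕ} (hi : i ≤ m.val) :
    partialSum d i ≤ i * d m := by
  induction i with
  | zero => simp [partialSum_zero]
  | succ i ih =>
    have h1 := ih (by omega)
    have him : i < n := by omega
    have h2 : d ⟨i, him⟩ ≤ d m := hmono (show i ≤ m.val by omega)
    rw [partialSum_succ d him, Nat.succ_mul]
    omega

lemma gridTop_add (hd : ∀ i, 1 ≤ d i) (m : Fin n) : gridTop d m + m.val = partialSum d m.val := by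
  have h1 : ∑ i : Fin n, (if i < m then 1 else 0) = m.val := by
    rw [← Finset.sum_filter, Finset.sum_const, smul_eq_mul, mul_one, Finset.filter_gt_eq_Iio,
      Fin.card_Iio]
  conv_lhs => rw [← h1]
  rw [gridTop, ← Finset.sum_add_distrib, partialSum, Finset.sum_filter]
  refine Finset.sum_congr rfl fun i _ => ?_
  have := hd i
  simp only [Fin.lt_def]
  split_ifs <;> omega

lemma partialSum_le_of_cond (hn : 0 < n) (hmono : Monotone d)
    (hcond : ∀ i : ℕ, 4 ≤ i → ∀ hi : i ≤ n,
      min (partialSum d (i - 1 - 1) - (i - 1 - 1)) ((partialSum d (i - 1) - (i - 1)) / 2) ≤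
        d ⟨i - 1, by omega⟩) (p : Fin n) :
    partialSum d p.val ≤ 2 * d p + p.val + 1 := by
  obtain ⟨p, hp⟩ := p
  have hle : ∀ i (hi : i < n), i ≤ p → d ⟨i, hi⟩ ≤ d ⟨p, hp⟩ := fun i hi hip => hmono hip
  rcases lt_or_ge p 3 with h | h
  · have h3 := partialSum_le hmono ⟨p, hp⟩ le_rfl
    simp only at h3 ⊢
    interval_cases p <;> omega
  · have h1 : min (partialSum d (p - 1) - (p - 1)) ((partialSum d p - p) / 2) ≤ d ⟨p, hp⟩ :=
      hcond (p + 1) (by omega) hp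
    obtain ⟨q, rfl⟩ : ∃ q, p = q + 1 := ⟨p - 1, by omega⟩
    rw [Nat.add_sub_cancel] at h1
    have h2 := partialSum_succ d (show q < n by omega)
    have h3 := hle q (by omega) (Nat.le_succ q)
    simp only
    omega

lemma gridTop_le_of_partialSum_le (hd : ∀ i, 1 ≤ d i) (hmono : Monotone d)
    (h : ∀ p : Fin n, partialSum d p.val ≤ 2 * d p + p.val + 1) (m : Fin n)
    (hm : m.val + 1 < n) : gridTop d m ≤ d m + d ⟨m.val + 1, hm⟩ := by
  have h1 := gridTop_add hd m
  have h2 := h m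
  have h3 : partialSum d (m.val + 1) ≤ 2 * d ⟨m.val + 1, hm⟩ + (m.val + 1) + 1 :=
    h ⟨m.val + 1, hm⟩
  have h4 : partialSum d (m.val + 1) = partialSum d m.val + d m := partialSum_succ d m.2
  have h5 := partialSum_le hmono m le_rfl
  have h6 := hd m
  rcases h6.eq_or_lt with h7 | h7
  · rw [← h7, mul_one] at h5
    omega
  · omega

lemma gridTop_add_add_le_of_partialSum_le (hd : ∀ i, 1 ≤ d i)
    (h : ∀ p : Fin n, partialSum d p.val ≤ 2 * d p + p.val + 1) (m : Fin n)
    (hm : m.val + 1 < n) (i : Fin n) (hi : i.val = m.val + 2) :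
    gridTop d m + d m + d ⟨m.val + 1, hm⟩ ≤ 2 * d i + 3 := by
  have h1 := gridTop_add hd m
  have h2 := h i
  have h3 : partialSum d (m.val + 1) = partialSum d m.val + d m := partialSum_succ d m.2
  have h4 : partialSum d (m.val + 2) = partialSum d (m.val + 1) + d ⟨m.val + 1, hm⟩ :=
    partialSum_succ d hm
  rw [hi] at h2
  omega

end Degrees

section Initial

variable {n : ℕ} {K : Type*} [Field K]

lemma degree_eq_of_coeff_ne_zero {p : MvPolynomial (Fin n) K} {t : ℕ} (hp : p.IsHomogeneous t)
    {ν : Fin n →₀ ℕ} (hν : coeff ν p ≠ 0) : ν.degree = t :=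
  by_contra fun h => hν (hp.coeff_eq_zero h)

lemma drlLT_of_degree_eq {ν μ : Fin n →₀ ℕ} (hdeg : ν.degree = μ.degree) {k : ℕ}
    (hμ : ∀ j : Fin n, k ≤ j.val → μ j = 0) (hν : ∃ j : Fin n, k ≤ j.val ∧ ν j ≠ 0) :
    DrlLT ν μ := by
  classical
  refine Or.inr ⟨hdeg, ?_⟩
  let s := Finset.univ.filter fun j : Fin n => k ≤ j.val ∧ ν j ≠ 0
  have hs : s.Nonempty := by
    obtain ⟨j, hj⟩ := hν
    exact ⟨j, by simpa [s] using hj⟩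
  obtain ⟨hk, h0⟩ : k ≤ (s.max' hs).val ∧ ν (s.max' hs) ≠ 0 := by
    simpa [s] using s.max'_mem hs
  refine ⟨s.max' hs, by rw [hμ _ hk]; omega, fun j hj => ?_⟩
  have hkj : k ≤ j.val := hk.trans (Fin.le_def.1 hj.le)
  rw [hμ j hkj]
  by_contra hne
  exact (s.le_max' j (by simp [s, hkj, hne])).not_gt hj

lemma monomial_mem_initialIdeal {I : Ideal (MvPolynomial (Fin n) K)} {p : MvPolynomial (Fin n) K}
    (hp : p ∈ I) {μ : Fin n →₀ ℕ} (hμ : IsLeadExp p μ) : monomial μ (1 : K) ∈ initialIdeal I :=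
  Ideal.subset_span ⟨p, hp, support_nonempty.1 ⟨μ, hμ.1⟩, μ, hμ, rfl⟩

lemma exists_isLeadExp_of_isMinGen {I : Ideal (MvPolynomial (Fin n) K)} (hI : IsGradedIdeal I)
    {μ : Fin n →₀ ℕ} (hμ : IsMinGen (initialIdeal I) μ) :
    ∃ p ∈ I, p.IsHomogeneous μ.degree ∧ IsLeadExp p μ := by
  have hspan : initialIdeal I = Ideal.span ((fun s => monomial s (1 : K)) ''
      {ν | ∃ p ∈ I, IsLeadExp p ν}) := by
    rw [initialIdeal]
    congr 1
    ext q
    constructor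
    · rintro ⟨p, hp, -, ν, hν, rfl⟩
      exact ⟨ν, ⟨p, hp, hν⟩, rfl⟩
    · rintro ⟨ν, ⟨p, hp, hν⟩, rfl⟩
      exact ⟨p, hp, support_nonempty.1 ⟨ν, hν.1⟩, ν, hν, rfl⟩
  have hmem := hμ.1
  rw [hspan, mem_ideal_span_monomial_image] at hmem
  obtain ⟨ν, ⟨p, hp, hν⟩, hle⟩ := hmem μ (by simp)
  obtain rfl : ν = μ := by
    by_contra hne
    exact hμ.2 ν hle hne (monomial_mem_initialIdeal hp hν)
  refine ⟨homogeneousComponent ν.degree p, hI p hp _, homogeneousComponent_isHomogeneous _ _,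
    ?_, fun κ hκ hne => ?_⟩
  · rw [mem_support_iff, coeff_homogeneousComponent, if_pos rfl]
    exact mem_support_iff.1 hν.1
  · rw [mem_support_iff, coeff_homogeneousComponent] at hκ
    split_ifs at hκ with h
    · exact hν.2 κ (mem_support_iff.2 hκ) hne
    · exact absurd rfl hκ

variable {f : Fin n → MvPolynomial (Fin n) K} {d : Fin n → ℕ}

lemma exists_sub_of_mem_truncIdeal (hf : ∀ i, (f i).IsHomogeneous (d i)) {k t : ℕ}
    {p : MvPolynomial (Fin n) K} (hp : p ∈ truncIdeal f k n) (hpt : p.IsHomogeneous t) :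
    ∃ r ∈ Ideal.span (Set.range f), r.IsHomogeneous t ∧
      ∀ ν, coeff ν p ≠ coeff ν r → ∃ j : Fin n, k ≤ j.val ∧ ν j ≠ 0 := by
  have hI : IsGradedIdeal (Ideal.span (Set.range f)) := isGradedIdeal_span (by
    rintro _ ⟨i, rfl⟩
    exact ⟨d i, hf i⟩)
  have hle : truncIdeal f k n ≤ Ideal.span (Set.range f) ⊔
      Ideal.span ((X : Fin n → MvPolynomial (Fin n) K) '' {j | k ≤ j.val}) :=
    truncIdeal_le (fun i _ => Ideal.mem_sup_left (Ideal.subset_span ⟨i, rfl⟩))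
      fun l hl => Ideal.mem_sup_right (Ideal.subset_span ⟨l, hl, rfl⟩)
  obtain ⟨a, ha, b, hb, rfl⟩ := Submodule.mem_sup.1 (hle hp)
  refine ⟨homogeneousComponent t a, hI a ha t, homogeneousComponent_isHomogeneous _ _,
    fun ν hν => ?_⟩
  rw [mem_ideal_span_X_image] at hb
  refine hb ν (mem_support_iff.2 fun h0 => hν ?_)
  have h1 : homogeneousComponent t (a + b) = a + b :=
    (homogeneousComponent_of_mem hpt).trans (if_pos rfl)
  rw [← h1, map_add, coeff_add, coeff_homogeneousComponent t b, h0, ite_self, add_zero]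

lemma mem_truncIdeal_of_support {k : ℕ} {p : MvPolynomial (Fin n) K}
    (hp : ∀ ν ∈ p.support, ∃ j : Fin n, k ≤ j.val ∧ ν j ≠ 0) (r : ℕ) : p ∈ truncIdeal f k r := by
  have h : p ∈ Ideal.span ((X : Fin n → MvPolynomial (Fin n) K) '' {j | k ≤ j.val}) :=
    mem_ideal_span_X_image.2 hp
  refine Ideal.span_le.2 ?_ h
  rintro _ ⟨j, hj, rfl⟩
  exact X_mem_truncIdeal j hj

lemma monomial_mem_initialIdeal_of_surjective (hf : ∀ i, (f i).IsHomogeneous (d i)) {k : ℕ}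
    {ν : Fin n →₀ ℕ} (hν : ∀ j : Fin n, k ≤ j.val → ν j = 0)
    (h : monomial ν (1 : K) ∈ truncIdeal f k n) :
    monomial ν (1 : K) ∈ initialIdeal (Ideal.span (Set.range f)) := by
  classical
  obtain ⟨r, hr, hrh, hrc⟩ := exists_sub_of_mem_truncIdeal hf h (isHomogeneous_monomial 1 rfl)
  refine monomial_mem_initialIdeal hr ⟨?_, fun κ hκ hne => ?_⟩
  · rw [mem_support_iff]
    intro h0
    obtain ⟨j, hj, hj0⟩ := hrc ν (by simp [h0])
    exact hj0 (hν j hj)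
  · rw [mem_support_iff] at hκ
    refine drlLT_of_degree_eq (degree_eq_of_coeff_ne_zero hrh hκ) hν (hrc κ ?_)
    rw [coeff_monomial, if_neg hne.symm]
    exact hκ.symm

lemma not_isMinGen_of_injective (hf : ∀ i, (f i).IsHomogeneous (d i)) {μ : Fin n →₀ ℕ}
    (hμ : IsMinGen (initialIdeal (Ideal.span (Set.range f))) μ) {m : Fin n} (hm : μ m ≠ 0)
    (hm0 : ∀ j : Fin n, m < j → μ j = 0) {s : ℕ} (hs : s + 1 = μ.degree)
    (hinj : ∀ q : MvPolynomial (Fin n) K, q.IsHomogeneous s →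
      q * X m ∈ truncIdeal f (m.val + 1) n → q ∈ truncIdeal f (m.val + 1) n) : False := by
  classical
  obtain ⟨p, hp, hph, hpμ⟩ := exists_isLeadExp_of_isMinGen (isGradedIdeal_span (by
    rintro _ ⟨i, rfl⟩
    exact ⟨d i, hf i⟩)) hμ
  have hpdeg : ∀ ν, coeff ν p ≠ 0 → ν.degree = μ.degree :=
    fun ν hν => degree_eq_of_coeff_ne_zero hph hν
  let q := p.divMonomial (Finsupp.single m 1)
  have hqc : ∀ ν, coeff ν q = coeff (Finsupp.single m 1 + ν) p :=
    fun ν => coeff_divMonomial _ _ _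
  have hqdeg : ∀ ν, coeff ν q ≠ 0 → ν.degree = s := fun ν hν => by
    rw [hqc] at hν
    have h1 := hpdeg _ hν
    rw [map_add, Finsupp.degree_single] at h1
    omega
  have hqh : q.IsHomogeneous s := fun ν hν => by
    rw [← hqdeg ν hν, Finsupp.degree_eq_weight_one]
    rfl
  have hpq : p = X m * q + p.modMonomial (Finsupp.single m 1) :=
    (divMonomial_add_modMonomial_single p m).symm
  have hI : Ideal.span (Set.range f) ≤ truncIdeal f (m.val + 1) n := by
    rw [Ideal.span_le]
    rintro _ ⟨i, rfl⟩
    exact mem_truncIdeal i i.2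
  have hqX : q * X m ∈ truncIdeal f (m.val + 1) n := by
    have h1 : p.modMonomial (Finsupp.single m 1) ∈ truncIdeal f (m.val + 1) n := by
      refine mem_truncIdeal_of_support (fun ν hν => ?_) n
      rw [mem_support_iff] at hν
      have hle : ¬ Finsupp.single m 1 ≤ ν := fun hle => hν (coeff_modMonomial_of_le p hle)
      rw [coeff_modMonomial_of_not_le p hle] at hν
      have hνm : ν m = 0 := by simpa [Finsupp.single_le_iff] using hle
      by_contra! hν0
      have hne : ν ≠ μ := fun h => hm (h ▸ hνm)
      rcases hpμ.2 ν (mem_support_iff.2 hν) hne with h | ⟨-, i, hi, hij⟩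
      · have h2 := hpdeg ν hν
        rw [expDeg_eq_degree, expDeg_eq_degree] at h
        omega
      · rcases lt_trichotomy i m with him | rfl | him
        · exact hm ((hij m him).symm.trans hνm)
        · omega
        · rw [hν0 i him] at hi
          omega
    have h2 := Ideal.sub_mem _ (hI hp) h1
    rwa [sub_eq_of_eq_add hpq, mul_comm] at h2
  obtain ⟨r, hr, hrh, hrc⟩ := exists_sub_of_mem_truncIdeal hf (hinj q hqh hqX) hqh
  obtain ⟨ρ, rfl⟩ : ∃ ρ, μ = Finsupp.single m 1 + ρ :=
    ⟨μ - Finsupp.single m 1, (add_tsub_cancel_of_le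
      (by simpa [Finsupp.single_le_iff, Nat.one_le_iff_ne_zero] using hm)).symm⟩
  have hρ0 : ∀ j : Fin n, m.val + 1 ≤ j.val → ρ j = 0 := fun j hj => by
    have h1 := hm0 j hj
    rw [Finsupp.add_apply] at h1
    omega
  have hρq : coeff ρ q ≠ 0 := by
    rw [hqc]
    exact mem_support_iff.1 hpμ.1
  refine hμ.2 ρ le_add_self (fun h => ?_) (monomial_mem_initialIdeal hr ⟨?_, fun κ hκ hne => ?_⟩)
  · have h1 := congrArg Finsupp.degree h
    rw [map_add, Finsupp.degree_single] at h1
    omega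
  · rw [mem_support_iff]
    intro h0
    obtain ⟨j, hj, hj0⟩ := hrc ρ (by rwa [h0])
    exact hj0 (hρ0 j hj)
  · rw [mem_support_iff] at hκ
    have hdeg : κ.degree = ρ.degree :=
      (degree_eq_of_coeff_ne_zero hrh hκ).trans (hqdeg ρ hρq).symm
    by_cases hc : coeff κ q = coeff κ r
    · rw [← hc, hqc] at hκ
      rcases hpμ.2 _ (mem_support_iff.2 hκ) (fun h => hne (add_left_cancel h))
        with h | ⟨-, i, hi, hij⟩
      · rw [expDeg_eq_degree, expDeg_eq_degree, map_add, map_add] at h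
        omega
      · refine Or.inr ⟨hdeg, i, ?_, fun j hj => ?_⟩
        · simpa using hi
        · simpa using hij j hj
    · exact drlLT_of_degree_eq hdeg hρ0 (hrc κ hc)

end Initial

/-- Conjecture E holds for a generic ideal of type `(n; d_1,…,d_n)` with `n ≥ 4`,
`d_1 ≤ ⋯ ≤ d_n` and `d_i ≥ σ_{i−1}` for `4 ≤ i ≤ n`. -/
theorem stmt16 {F K : Type*} [Field F] [Field K] [Algebra F K] [Infinite K]
    {n : ℕ} (hn4 : 4 ≤ n) (d : Fin n → ℕ) (hd : ∀ i, 1 ≤ d i) (hmono : Monotone d)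
    (f : Fin n → MvPolynomial (Fin n) K) (hf : IsGenericSeq F d f)
    (I : Ideal (MvPolynomial (Fin n) K)) (hI : I = Ideal.span (Set.range f))
    (δf σf : ℕ → ℕ)
    (hδf : ∀ i : ℕ, δf i = (∑ j ∈ Finset.univ.filter (fun j : Fin n => (j : ℕ) < i), d j) - i)
    (hσf : ∀ i : ℕ, σf i = min (δf (i - 1)) (δf i / 2))
    (hcond : ∀ i : ℕ, 4 ≤ i → ∀ hi : i ≤ n, σf (i - 1) ≤ d ⟨i - 1, by omega⟩) :
    ConjE I := by
  subst hI
  have hsum := partialSum_le_of_cond (by omega) hmono fun i hi4 hi => by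
    have h := hcond i hi4 hi
    rwa [hσf, hδf, hδf] at h
  intro μ hμ m hm hm0 ν hν hν0
  rw [expDeg_eq_degree, expDeg_eq_degree] at hν
  have hμdeg : 0 < μ.degree := (Nat.pos_of_ne_zero hm).trans_le (Finsupp.le_degree m μ)
  rcases Nat.eq_zero_or_pos m.val with h0 | h0
  · have h1 : ν = 0 := by
      ext j
      exact hν0 j (by rw [Fin.le_def]; omega)
    rw [h1, map_zero] at hν
    omega
  · let l : Fin n := ⟨m.val - 1, by omega⟩
    have hl : l.val + 1 = m.val := Nat.sub_add_cancel h0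
    have hln : l.val + 1 < n := by omega
    have hlm : (⟨l.val + 1, hln⟩ : Fin n) = m := Fin.ext hl
    have hl2 : l.val + 2 = m.val + 1 := by omega
    have key := mem_truncIdeal_or_injective hf hd hmono l hln
      (gridTop_le_of_partialSum_le hd hmono hsum l hln)
      (gridTop_add_add_le_of_partialSum_le hd hsum l hln) (Nat.sub_add_cancel hμdeg)
    rw [hlm, hl, hl2] at key
    rcases key with h | h
    · exact monomial_mem_initialIdeal_of_surjective hf.1 (fun j hj => hν0 j hj)
        (h _ (isHomogeneous_monomial 1 hν))
    · exact (not_isMinGen_of_injective hf.1 hμ hm hm0 (Nat.sub_add_cancel hμdeg) h).elim
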